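/- arXiv:1711.07590 — 5 statements merged into one kernel-verified Lean document; each statement's English description precedes it below -/
import Mathlib

section
/- Let ω be a nonnegative σ-finite measure on ℂ satisfying ∫_ℂ (1+|u|)^{−1} dω(u) < ∞, and let r > 0 be such that ∫_ℂ |r² − |u|²|^{−1/2} dω(u) < ∞. Then ∫_ℂ ∫_ℂ ∫_0^{2π} (|u − r·e^{iθ}|·|conj(w) − r·e^{−iθ}|)^{−1} dθ dω(u) dω(w) < ∞. -/
open MeasureTheory Metric Real Filter
open scoped ENNReal NNReal Topology

/-- Biot-Savart velocity field of a vorticity measure `ω` on `ℂ = ℝ²`: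
`v(z) = (2π)⁻¹ ∫ i (z - u) / |z - u|² dω(u)`. -/
noncomputable def biotSavart (ω : Measure ℂ) (z : ℂ) : ℂ :=
  (2 * π)⁻¹ • ∫ u, Complex.I * (z - u) / (((‖z - u‖ : ℝ) : ℂ) ^ 2) ∂ω

/-- Local kinetic energy `E_r(ω) = ∫_{B(0,r)} |v|²`. -/
noncomputable def localEnergy (ω : Measure ℂ) (r : ℝ) : ℝ≥0∞ :=
  ∫⁻ x in ball (0 : ℂ) r, (‖biotSavart ω x‖₊ : ℝ≥0∞) ^ 2

/-- Spherical average `A_r(ω) = (2π)⁻¹ ∫_0^{2π} |v(r e^{iθ})|² dθ`. -/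
noncomputable def sphAvg (ω : Measure ℂ) (r : ℝ) : ℝ≥0∞ :=
  (ENNReal.ofReal (2 * π))⁻¹ *
    ∫⁻ θ in Set.Ioo (0 : ℝ) (2 * π),
      (‖biotSavart ω ((r : ℂ) * Complex.exp ((θ : ℂ) * Complex.I))‖₊ : ℝ≥0∞) ^ 2

/-- Inner moments `m_{r,n}(ω) = ∫_{B(0,r)} uⁿ dω(u)` (for `n = 0` this is `ω(B(0,r))`). -/
noncomputable def innerMoment (ω : Measure ℂ) (r : ℝ) (n : ℕ) : ℂ :=
  ∫ u in ball (0 : ℂ) r, u ^ n ∂ω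

/-- Outer moments `M_{r,k}(ω) = ∫_{ℂ ∖ B(0,r)} u⁻ᵏ dω(u)`. -/
noncomputable def outerMoment (ω : Measure ℂ) (r : ℝ) (k : ℕ) : ℂ :=
  ∫ u in (ball (0 : ℂ) r)ᶜ, u ^ (-(k : ℤ)) ∂ω

/-- The circle integral of the inverse square distance to an interior point, obtained from the
Poisson integral formula. -/
lemma integral_inv_sq_norm_sub_circleMap_of_lt {u : ℂ} {r : ℝ} (hu : ‖u‖ < r) :
    ∫ θ in (0 : ℝ)..2 * π, (‖u - circleMap 0 r θ‖ ^ 2)⁻¹ = 2 * π / (r ^ 2 - ‖u‖ ^ 2) := by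
  have hr : 0 < r := (norm_nonneg u).trans_lt hu
  have hpos : 0 < r ^ 2 - ‖u‖ ^ 2 := by nlinarith [norm_nonneg u]
  have hdc : DiffContOnCl ℂ (fun _ : ℂ ↦ (1 : ℂ)) (ball 0 r) := diffContOnCl_const
  have hP := hdc.circleAverage_poissonKernel_smul (w := u) (by simpa using hu)
  have hker (θ : ℝ) : poissonKernel 0 u (circleMap 0 r θ) =
      (r ^ 2 - ‖u‖ ^ 2) * (‖u - circleMap 0 r θ‖ ^ 2)⁻¹ := by
    simp [poissonKernel_def, norm_circleMap_zero, div_eq_mul_inv, norm_sub_rev]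
  have hR : (2 * π)⁻¹ * ((r ^ 2 - ‖u‖ ^ 2) *
      ∫ θ in (0 : ℝ)..2 * π, (‖u - circleMap 0 r θ‖ ^ 2)⁻¹) = 1 := by
    rw [← intervalIntegral.integral_const_mul]
    simp_rw [← hker]
    simp only [circleAverage_def, Pi.smul_apply', Complex.real_smul, mul_one,
      intervalIntegral.integral_ofReal] at hP
    exact_mod_cast hP
  have := Real.pi_pos
  field_simp at hR ⊢
  linarith

/-- Inversion in the circle of radius `r` rescales the distance to its points. -/
lemma norm_sub_circleMap_eq_inversion {u : ℂ} (hu : u ≠ 0) {r : ℝ} (hr : 0 < r) (θ : ℝ) :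
    ‖u - circleMap 0 r θ‖ =
      ‖u‖ / r * ‖(r : ℂ) ^ 2 / (starRingEnd ℂ) u - circleMap 0 r θ‖ := by
  have hu' : (starRingEnd ℂ) u ≠ 0 := by simpa using hu
  have hr' : (r : ℂ) ≠ 0 := by exact_mod_cast hr.ne'
  set z := circleMap 0 r θ with hz
  have hzr : z * (starRingEnd ℂ) z = (r : ℂ) ^ 2 := by
    rw [Complex.mul_conj, Complex.normSq_eq_norm_sq, hz, norm_circleMap_zero, sq_abs]
    push_cast
    rfl
  have hfac : (r : ℂ) ^ 2 / (starRingEnd ℂ) u - z =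
      z * (starRingEnd ℂ) (z - u) / (starRingEnd ℂ) u := by
    rw [map_sub, mul_sub, hzr]
    field_simp
  rw [hfac, norm_div, norm_mul, Complex.norm_conj, Complex.norm_conj, hz, norm_circleMap_zero,
    abs_of_pos hr, norm_sub_rev]
  have := norm_pos_iff.2 hu
  field_simp

/-- The circle integral of the inverse square distance to a point off the circle. -/
lemma integral_inv_sq_norm_sub_circleMap {u : ℂ} {r : ℝ} (hr : 0 < r) (hu : ‖u‖ ≠ r) :
    ∫ θ in (0 : ℝ)..2 * π, (‖u - circleMap 0 r θ‖ ^ 2)⁻¹ = 2 * π / |r ^ 2 - ‖u‖ ^ 2| := by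
  rcases hu.lt_or_gt with h | h
  · rw [integral_inv_sq_norm_sub_circleMap_of_lt h, abs_of_pos]
    nlinarith [norm_nonneg u]
  · have hu0 : 0 < ‖u‖ := hr.trans h
    have hnorm : ‖(r : ℂ) ^ 2 / (starRingEnd ℂ) u‖ = r ^ 2 / ‖u‖ := by
      simp
    have hlt : ‖(r : ℂ) ^ 2 / (starRingEnd ℂ) u‖ < r := by
      rw [hnorm, div_lt_iff₀ hu0]
      nlinarith
    simp_rw [norm_sub_circleMap_eq_inversion (norm_pos_iff.1 hu0) hr, mul_pow, mul_inv]
    rw [intervalIntegral.integral_const_mul, integral_inv_sq_norm_sub_circleMap_of_lt hlt, hnorm,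
      abs_of_neg (by nlinarith)]
    have h1 : ‖u‖ ^ 2 - r ^ 2 ≠ 0 := by nlinarith
    have h2 : r ^ 2 - (r ^ 2 / ‖u‖) ^ 2 = r ^ 2 / ‖u‖ ^ 2 * (‖u‖ ^ 2 - r ^ 2) := by
      field_simp
    rw [h2, neg_sub]
    field_simp

lemma continuous_inv_norm_sub_circleMap {u : ℂ} {r : ℝ} (hr : 0 < r) (hu : ‖u‖ ≠ r) :
    Continuous fun θ : ℝ ↦ ‖u - circleMap 0 r θ‖⁻¹ := by
  have hc : Continuous fun θ : ℝ ↦ ‖u - circleMap 0 r θ‖ := by fun_prop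
  refine hc.inv₀ fun θ hθ ↦ hu ?_
  rw [norm_eq_zero, sub_eq_zero] at hθ
  rw [hθ, norm_circleMap_zero, abs_of_pos hr]

/-- Cauchy–Schwarz bound for the product of two inverse distances along a circle. -/
lemma integral_inv_norm_mul_inv_norm_circleMap_le {u w : ℂ} {r : ℝ} (hr : 0 < r)
    (hu : ‖u‖ ≠ r) (hw : ‖w‖ ≠ r) :
    ∫ θ in (0 : ℝ)..2 * π, ‖u - circleMap 0 r θ‖⁻¹ * ‖w - circleMap 0 r θ‖⁻¹ ≤
      2 * π * ((√|r ^ 2 - ‖u‖ ^ 2|)⁻¹ * (√|r ^ 2 - ‖w‖ ^ 2|)⁻¹) := by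
  have habs {v : ℂ} (hv : ‖v‖ ≠ r) : 0 < |r ^ 2 - ‖v‖ ^ 2| := by
    rw [abs_pos, sub_ne_zero]
    exact fun h ↦ hv ((sq_eq_sq₀ (norm_nonneg v) hr.le).1 h.symm)
  have hIu := integral_inv_sq_norm_sub_circleMap hr hu
  have hIw := integral_inv_sq_norm_sub_circleMap hr hw
  have cu := continuous_inv_norm_sub_circleMap hr hu
  have cw := continuous_inv_norm_sub_circleMap hr hw
  simp_rw [← inv_pow] at hIu hIw
  rw [← Real.sq_sqrt (habs hu).le] at hIu
  rw [← Real.sq_sqrt (habs hw).le] at hIw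
  have ha := Real.sqrt_pos.2 (habs hu)
  have hb := Real.sqrt_pos.2 (habs hw)
  set a := √|r ^ 2 - ‖u‖ ^ 2|
  set b := √|r ^ 2 - ‖w‖ ^ 2|
  have iu : IntervalIntegrable (fun θ ↦ a / (2 * b) * ‖u - circleMap 0 r θ‖⁻¹ ^ 2)
      volume 0 (2 * π) := (continuous_const.mul (cu.pow 2)).intervalIntegrable _ _
  have iw : IntervalIntegrable (fun θ ↦ b / (2 * a) * ‖w - circleMap 0 r θ‖⁻¹ ^ 2)
      volume 0 (2 * π) := (continuous_const.mul (cw.pow 2)).intervalIntegrable _ _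
  have hmono : ∫ θ in (0 : ℝ)..2 * π, ‖u - circleMap 0 r θ‖⁻¹ * ‖w - circleMap 0 r θ‖⁻¹ ≤
      ∫ θ in (0 : ℝ)..2 * π, (a / (2 * b) * ‖u - circleMap 0 r θ‖⁻¹ ^ 2 +
        b / (2 * a) * ‖w - circleMap 0 r θ‖⁻¹ ^ 2) := by
    refine intervalIntegral.integral_mono_on Real.two_pi_pos.le
      ((cu.mul cw).intervalIntegrable _ _)
      (iu.add iw) fun θ _ ↦ ?_
    set x := ‖u - circleMap 0 r θ‖⁻¹
    set y := ‖w - circleMap 0 r θ‖⁻¹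
    have key : a / (2 * b) * x ^ 2 + b / (2 * a) * y ^ 2 - x * y =
        (a * x - b * y) ^ 2 / (2 * a * b) := by
      field_simp
      ring
    have : 0 ≤ (a * x - b * y) ^ 2 / (2 * a * b) := by positivity
    linarith
  refine hmono.trans_eq ?_
  rw [intervalIntegral.integral_add iu iw, intervalIntegral.integral_const_mul,
    intervalIntegral.integral_const_mul, hIu, hIw]
  field_simp
  ring

/-- The bound of `integral_inv_norm_mul_inv_norm_circleMap_le` in `ℝ≥0∞`, valid for all points. -/
lemma lintegral_inv_norm_mul_norm_circleMap_le (u w : ℂ) {r : ℝ} (hr : 0 < r) :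
    ∫⁻ θ in Set.Ioo (0 : ℝ) (2 * π),
        (ENNReal.ofReal (‖u - circleMap 0 r θ‖ * ‖w - circleMap 0 r θ‖))⁻¹ ≤
      ENNReal.ofReal (2 * π) * ((ENNReal.ofReal √|r ^ 2 - ‖u‖ ^ 2|)⁻¹ *
        (ENNReal.ofReal √|r ^ 2 - ‖w‖ ^ 2|)⁻¹) := by
  have hpi : ENNReal.ofReal (2 * π) ≠ 0 := by simpa using Real.pi_pos
  by_cases hu : ‖u‖ = r
  · rw [hu, sub_self, abs_zero, Real.sqrt_zero, ENNReal.ofReal_zero, ENNReal.inv_zero,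
      ENNReal.top_mul (ENNReal.inv_ne_zero.2 ENNReal.ofReal_ne_top), ENNReal.mul_top hpi]
    exact le_top
  by_cases hw : ‖w‖ = r
  · rw [hw, sub_self, abs_zero, Real.sqrt_zero, ENNReal.ofReal_zero, ENNReal.inv_zero,
      ENNReal.mul_top (ENNReal.inv_ne_zero.2 ENNReal.ofReal_ne_top), ENNReal.mul_top hpi]
    exact le_top
  have hne {v : ℂ} (hv : ‖v‖ ≠ r) (θ : ℝ) : 0 < ‖v - circleMap 0 r θ‖ := by
    rw [norm_pos_iff, sub_ne_zero]
    rintro rfl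
    exact hv (by rw [norm_circleMap_zero, abs_of_pos hr])
  have habs {v : ℂ} (hv : ‖v‖ ≠ r) : 0 < √|r ^ 2 - ‖v‖ ^ 2| := by
    rw [Real.sqrt_pos, abs_pos, sub_ne_zero]
    exact fun h ↦ hv ((sq_eq_sq₀ (norm_nonneg v) hr.le).1 h.symm)
  have hint : IntervalIntegrable
      (fun θ ↦ ‖u - circleMap 0 r θ‖⁻¹ * ‖w - circleMap 0 r θ‖⁻¹) volume 0 (2 * π) :=
    ((continuous_inv_norm_sub_circleMap hr hu).mul
    (continuous_inv_norm_sub_circleMap hr hw)).intervalIntegrable _ _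
  rw [intervalIntegrable_iff_integrableOn_Ioo_of_le Real.two_pi_pos.le] at hint
  have hle := integral_inv_norm_mul_inv_norm_circleMap_le hr hu hw
  rw [intervalIntegral.integral_of_le Real.two_pi_pos.le, integral_Ioc_eq_integral_Ioo] at hle
  calc
    _ = ∫⁻ θ in Set.Ioo (0 : ℝ) (2 * π),
        ENNReal.ofReal (‖u - circleMap 0 r θ‖⁻¹ * ‖w - circleMap 0 r θ‖⁻¹) := by
      refine lintegral_congr fun θ ↦ ?_
      rw [← mul_inv, ENNReal.ofReal_inv_of_pos (mul_pos (hne hu θ) (hne hw θ))]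
    _ = ENNReal.ofReal (∫ θ in Set.Ioo (0 : ℝ) (2 * π),
        ‖u - circleMap 0 r θ‖⁻¹ * ‖w - circleMap 0 r θ‖⁻¹) :=
      (ofReal_integral_eq_lintegral_ofReal hint (ae_of_all _ fun θ ↦ by positivity)).symm
    _ ≤ ENNReal.ofReal (2 * π * ((√|r ^ 2 - ‖u‖ ^ 2|)⁻¹ * (√|r ^ 2 - ‖w‖ ^ 2|)⁻¹)) :=
      ENNReal.ofReal_le_ofReal hle
    _ = _ := by
      rw [ENNReal.ofReal_mul Real.two_pi_pos.le,
        ENNReal.ofReal_mul (inv_nonneg.2 (Real.sqrt_nonneg _)),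
        ENNReal.ofReal_inv_of_pos (habs hu), ENNReal.ofReal_inv_of_pos (habs hw)]

/-- Corollary 3.7: finiteness of the triple integral, for `r` in the set `G`. -/
theorem stmt9 (ω : Measure ℂ) [SigmaFinite ω]
    (hω : ∫⁻ u, ENNReal.ofReal ((1 + ‖u‖)⁻¹) ∂ω < ⊤)
    (r : ℝ) (hr : 0 < r)
    (hG : ∫⁻ u, (ENNReal.ofReal (Real.sqrt |r ^ 2 - ‖u‖ ^ 2|))⁻¹ ∂ω < ⊤) :
    (∫⁻ w, ∫⁻ u,
        (∫⁻ θ in Set.Ioo (0 : ℝ) (2 * π),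
          (ENNReal.ofReal (‖u - (r : ℂ) * Complex.exp ((θ : ℂ) * Complex.I)‖ *
            ‖(starRingEnd ℂ) w - (r : ℂ) * Complex.exp (-(θ : ℂ) * Complex.I)‖))⁻¹)
        ∂ω ∂ω) < ⊤ := by
  have hmap (θ : ℝ) : (r : ℂ) * Complex.exp ((θ : ℂ) * Complex.I) = circleMap 0 r θ := by
    simp [circleMap]
  have hconj (w : ℂ) (θ : ℝ) :
      ‖(starRingEnd ℂ) w - (r : ℂ) * Complex.exp (-(θ : ℂ) * Complex.I)‖ =
        ‖w - circleMap 0 r θ‖ := by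
    rw [← hmap, ← Complex.norm_conj (w - _), map_sub, map_mul, ← Complex.exp_conj]
    simp
  simp_rw [hmap, hconj]
  set g : ℂ → ℝ≥0∞ := fun u ↦ (ENNReal.ofReal √|r ^ 2 - ‖u‖ ^ 2|)⁻¹ with hg
  have hgm : Measurable g := by fun_prop
  calc
    _ ≤ ∫⁻ w, ∫⁻ u, ENNReal.ofReal (2 * π) * (g u * g w) ∂ω ∂ω :=
      lintegral_mono fun w ↦ lintegral_mono fun u ↦
        lintegral_inv_norm_mul_norm_circleMap_le u w hr
    _ = ENNReal.ofReal (2 * π) * ((∫⁻ u, g u ∂ω) * ∫⁻ w, g w ∂ω) := by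
      simp_rw [lintegral_const_mul _ (hgm.mul_const _), lintegral_mul_const _ hgm]
      rw [lintegral_const_mul _ (hgm.const_mul _), lintegral_const_mul _ hgm]
    _ < ⊤ := ENNReal.mul_lt_top ENNReal.ofReal_lt_top (ENNReal.mul_lt_top hG hG)
end

section
/- Let ω₁ and ω₂ be nonnegative σ-finite measures on ℂ, each satisfying ∫_ℂ (1+|u|)^{−1} dω_i(u) < ∞, and let v = v₁ − v₂ be the difference of their Biot-Savart velocities. Then for Lebesgue-almost every r > 0 one has 4π²·(2π)^{−1} ∫_0^{2π} |v(r·e^{iθ})|² dθ = Σ_{n=0}^∞ r^{−2n−2}·|m_{r,n}(ω₁) − m_{r,n}(ω₂)|² + Σ_{k=1}^∞ r^{2k−2}·|M_{r,k}(ω₁) − M_{r,k}(ω₂)|². -/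
open MeasureTheory Metric Real Filter
open scoped ENNReal NNReal Topology

open AddCircle in
lemma integral_continuousMap_mul_eq_zero_of_fourierCoeff_eq_zero {T : ℝ} [Fact (0 < T)]
    {f : AddCircle T → ℂ} (hf : Integrable f haarAddCircle) (h : ∀ n, fourierCoeff f n = 0)
    (g : C(AddCircle T, ℂ)) : ∫ x, g x * f x ∂haarAddCircle = 0 := by
  have hint (g : C(AddCircle T, ℂ)) : Integrable (fun x ↦ g x * f x) haarAddCircle :=
    hf.bdd_mul (c := ‖g‖) g.continuous.aestronglyMeasurable
      (Eventually.of_forall g.norm_coe_le_norm)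
  have hcont : Continuous fun g : C(AddCircle T, ℂ) ↦ ∫ x, g x * f x ∂haarAddCircle := by
    refine continuous_iff_continuousAt.2 fun g₀ ↦ ?_
    refine tendsto_integral_filter_of_dominated_convergence (fun x ↦ (‖g₀‖ + 1) * ‖f x‖)
      (Eventually.of_forall fun g ↦ (hint g).1) ?_ (hf.norm.const_mul _)
      (Eventually.of_forall fun x ↦ ?_)
    · filter_upwards [Metric.ball_mem_nhds g₀ one_pos] with g hg
      refine Eventually.of_forall fun x ↦ ?_
      rw [norm_mul]
      gcongr
      have h1 : ‖g‖ ≤ ‖g₀‖ + ‖g - g₀‖ := by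
        simpa using norm_add_le g₀ (g - g₀)
      have h2 : ‖g - g₀‖ < 1 := by simpa [dist_eq_norm] using hg
      linarith [g.norm_coe_le_norm x]
    · exact ((continuous_eval_const x).tendsto g₀).mul_const _
  have hmem : g ∈ (Submodule.span ℂ (Set.range (@fourier T))).topologicalClosure := by
    rw [span_fourier_closure_eq_top]; trivial
  have hclosed : IsClosed {g : C(AddCircle T, ℂ) | ∫ x, g x * f x ∂haarAddCircle = 0} :=
    isClosed_eq hcont continuous_const
  rw [← SetLike.mem_coe, Submodule.topologicalClosure_coe] at hmem
  refine closure_minimal ?_ hclosed hmem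
  intro g hg
  change ∫ x, g x * f x ∂haarAddCircle = 0
  refine Submodule.span_induction (p := fun g _ ↦ ∫ x, g x * f x ∂haarAddCircle = 0)
    ?_ (by simp) ?_ ?_ hg
  · rintro _ ⟨n, rfl⟩
    simpa [fourierCoeff] using h (-n)
  · intro g₁ g₂ _ _ h₁ h₂
    simp only [ContinuousMap.add_apply, add_mul]
    rw [integral_add (hint g₁) (hint g₂), h₁, h₂, add_zero]
  · intro c g _ hg
    simp only [ContinuousMap.smul_apply, smul_eq_mul, mul_assoc]
    rw [integral_const_mul, hg, mul_zero]

open AddCircle in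
/-- An integrable function on the circle is determined by its Fourier coefficients. -/
lemma ae_eq_zero_of_fourierCoeff_eq_zero {T : ℝ} [Fact (0 < T)]
    {f : AddCircle T → ℂ} (hf : Integrable f haarAddCircle) (h : ∀ n, fourierCoeff f n = 0) :
    f =ᵐ[haarAddCircle] 0 := by
  refine ae_eq_zero_of_forall_setIntegral_isClosed_eq_zero hf fun s hs ↦ ?_
  have hlim : Tendsto (fun n ↦ ∫ x, ((hs.apprSeq n x : ℝ) : ℂ) * f x ∂haarAddCircle) atTop
      (𝓝 (∫ x, s.indicator f x ∂haarAddCircle)) := by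
    refine tendsto_integral_of_dominated_convergence (fun x ↦ ‖f x‖) (fun n ↦ ?_) hf.norm
      (fun n ↦ Eventually.of_forall fun x ↦ ?_) (Eventually.of_forall fun x ↦ ?_)
    · exact (Continuous.aestronglyMeasurable (by fun_prop)).mul hf.1
    · rw [norm_mul]
      refine mul_le_of_le_one_left (norm_nonneg _) ?_
      simpa using HasOuterApproxClosed.apprSeq_apply_le_one hs n x
    · have h1 := tendsto_pi_nhds.1 (HasOuterApproxClosed.tendsto_apprSeq hs) x
      have h2 : Tendsto (fun n ↦ ((hs.apprSeq n x : ℝ) : ℂ)) atTop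
          (𝓝 (((s.indicator (fun _ ↦ (1 : ℝ≥0)) x : ℝ≥0) : ℝ) : ℂ)) :=
        (Complex.continuous_ofReal.comp NNReal.continuous_coe).continuousAt.tendsto.comp h1
      convert h2.mul_const (f x) using 2
      by_cases hx : x ∈ s <;> simp [hx]
  rw [integral_indicator hs.measurableSet] at hlim
  refine tendsto_nhds_unique hlim ?_
  refine tendsto_const_nhds.congr fun n ↦ ?_
  exact (integral_continuousMap_mul_eq_zero_of_fourierCoeff_eq_zero hf h
    ⟨fun x ↦ ((hs.apprSeq n x : ℝ) : ℂ), by fun_prop⟩).symm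

open AddCircle in
lemma lintegral_enorm_sq_eq_tsum_fourierCoeff_of_memLp {T : ℝ} [Fact (0 < T)]
    {f : AddCircle T → ℂ} (hf : MemLp f 2 haarAddCircle) :
    ∫⁻ x, ‖f x‖ₑ ^ 2 ∂haarAddCircle = ∑' n, ‖fourierCoeff f n‖ₑ ^ 2 := by
  have h := hasSum_sq_fourierCoeff hf.toLp
  simp_rw [fourierCoeff_congr_ae hf.coeFn_toLp] at h
  have h3 : ∫ x, ‖hf.toLp f x‖ ^ 2 ∂haarAddCircle = ∫ x, ‖f x‖ ^ 2 ∂haarAddCircle :=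
    integral_congr_ae (by filter_upwards [hf.coeFn_toLp] with x hx; rw [hx])
  rw [h3] at h
  have h1 : ∀ z : ℂ, ‖z‖ₑ ^ 2 = ENNReal.ofReal (‖z‖ ^ 2) := fun z ↦ by
    rw [ENNReal.ofReal_pow (norm_nonneg _), ofReal_norm]
  simp_rw [h1]
  rw [← ENNReal.ofReal_tsum_of_nonneg (fun _ ↦ by positivity) h.summable, h.tsum_eq,
    ofReal_integral_eq_lintegral_ofReal hf.integrable_norm_pow' (ae_of_all _ fun _ ↦ by positivity)]

open AddCircle in
/-- **Parseval's identity** for integrable functions, as an identity in `[0, ∞]`. -/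
lemma lintegral_enorm_sq_eq_tsum_fourierCoeff {T : ℝ} [Fact (0 < T)]
    {f : AddCircle T → ℂ} (hf : Integrable f haarAddCircle) :
    ∫⁻ x, ‖f x‖ₑ ^ 2 ∂haarAddCircle = ∑' n, ‖fourierCoeff f n‖ₑ ^ 2 := by
  by_cases hfin : ∑' n, ‖fourierCoeff f n‖ₑ ^ 2 = ⊤
  · by_cases hL : MemLp f 2 haarAddCircle
    · exact lintegral_enorm_sq_eq_tsum_fourierCoeff_of_memLp hL
    · rw [hfin]
      by_contra hne
      refine hL ((memLp_two_iff_integrable_sq_norm hf.1).2 ⟨hf.1.norm.pow 2, ?_⟩)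
      simpa [hasFiniteIntegral_iff_enorm] using lt_top_iff_ne_top.2 hne
  · have hmem : Memℓp (fourierCoeff f) 2 := by
      refine memℓp_gen ?_
      have := ENNReal.summable_toReal hfin
      simpa using this
    let g : Lp ℂ 2 haarAddCircle := (fourierBasis (T := T)).repr.symm ⟨fourierCoeff f, hmem⟩
    have hg : ∀ n, fourierCoeff g n = fourierCoeff f n := fun n ↦ by
      rw [← fourierBasis_repr]; simp [g]
    have hgL : MemLp g 2 haarAddCircle := Lp.memLp g
    have hgi : Integrable g haarAddCircle := hgL.integrable one_le_two
    have h0 : f - ⇑g =ᵐ[haarAddCircle] 0 := by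
      refine ae_eq_zero_of_fourierCoeff_eq_zero (hf.sub hgi) fun n ↦ ?_
      have h1 : f = (f - ⇑g) + ⇑g := by simp
      have h2 := congrArg (fun φ ↦ φ n) (fourierCoeff.add (hf.sub hgi) hgi)
      rw [← h1] at h2
      simpa [hg] using h2
    have hfg : f =ᵐ[haarAddCircle] g := by
      filter_upwards [h0] with x hx using sub_eq_zero.1 hx
    exact lintegral_enorm_sq_eq_tsum_fourierCoeff_of_memLp (hgL.ae_eq hfg.symm)

lemma norm_fourier_apply {T : ℝ} (n : ℤ) (x : AddCircle T) : ‖fourier n x‖ = 1 := by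
  rw [fourier_apply]; exact Circle.norm_coe _

open AddCircle in
lemma hasSum_fourierCoeff_of_hasSum_fourier {T : ℝ} [Fact (0 < T)] {a : ℕ → ℂ} {e : ℕ → ℤ}
    {f : AddCircle T → ℂ} (ha : Summable fun n ↦ ‖a n‖)
    (hf : ∀ x, HasSum (fun n ↦ a n * fourier (e n) x) (f x)) (m : ℤ) :
    HasSum (fun n ↦ a n * (Pi.single (e n) 1 : ℤ → ℂ) m) (fourierCoeff f m) := by
  have h := hasSum_integral_of_summable_integral_norm (μ := haarAddCircle (T := T))
    (F := fun n x ↦ fourier (-m) x * (a n * fourier (e n) x)) (fun n ↦ ?_) ?_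
  · convert! h using 1
    · ext n
      rw [← fourierCoeff_fourier (T := T), fourierCoeff, ← integral_const_mul]
      simp only [smul_eq_mul]
      congr 1 with x
      ring
    · rw [fourierCoeff]
      congr 1 with x
      rw [tsum_mul_left, (hf x).tsum_eq, smul_eq_mul]
  · exact (Continuous.integrable_of_hasCompactSupport (by fun_prop)
      (HasCompactSupport.of_compactSpace _))
  · simpa only [norm_mul, norm_fourier_apply, mul_one, one_mul, integral_const, probReal_univ,
      one_smul] using ha

open AddCircle in
lemma fourierCoeff_eq_of_hasSum_fourier {T : ℝ} [Fact (0 < T)] {a : ℕ → ℂ} {e : ℕ → ℤ}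
    {f : AddCircle T → ℂ} (he : Function.Injective e) (ha : Summable fun n ↦ ‖a n‖)
    (hf : ∀ x, HasSum (fun n ↦ a n * fourier (e n) x) (f x)) (n : ℕ) :
    fourierCoeff f (e n) = a n := by
  refine (hasSum_fourierCoeff_of_hasSum_fourier ha hf (e n)).unique ?_
  simpa using hasSum_single (f := fun k ↦ a k * (Pi.single (e k) 1 : ℤ → ℂ) (e n)) n
    fun k hk ↦ by simp [he.ne hk.symm]

open AddCircle in
lemma fourierCoeff_eq_zero_of_hasSum_fourier {T : ℝ} [Fact (0 < T)] {a : ℕ → ℂ} {e : ℕ → ℤ}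
    {f : AddCircle T → ℂ} (ha : Summable fun n ↦ ‖a n‖)
    (hf : ∀ x, HasSum (fun n ↦ a n * fourier (e n) x) (f x)) {m : ℤ} (hm : ∀ n, m ≠ e n) :
    fourierCoeff f m = 0 := by
  refine (hasSum_fourierCoeff_of_hasSum_fourier ha hf m).unique ?_
  simp [Pi.single_eq_of_ne (hm _), hasSum_zero]

lemma fourier_eq_fourier_one_zpow {T : ℝ} (n : ℤ) (x : AddCircle T) :
    fourier n x = (fourier 1 x) ^ n := by
  rw [fourier_one, fourier_apply, AddCircle.toCircle_zsmul, Circle.coe_zpow]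

/-- The Cauchy kernel `1 / (z - u)` on the circle of radius `r`, in the angular variable. -/
noncomputable def circleCauchyKernel (r : ℝ) (x : AddCircle (2 * π)) (u : ℂ) : ℂ :=
  (r * fourier 1 x - u)⁻¹

lemma hasSum_circleCauchyKernel_of_norm_lt {r : ℝ} {u : ℂ} (hu : ‖u‖ < r)
    (x : AddCircle (2 * π)) :
    HasSum (fun n : ℕ ↦ (u ^ n * (r : ℂ) ^ (-((n : ℤ) + 1))) * fourier (-((n : ℤ) + 1)) x)
      (circleCauchyKernel r x u) := by
  have hr : 0 < r := (norm_nonneg u).trans_lt hu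
  have hr0 : (r : ℂ) ≠ 0 := by exact_mod_cast hr.ne'
  have hw := norm_fourier_apply 1 x
  have hw0 : fourier 1 x ≠ 0 := fun h ↦ by simp [h] at hw
  have hlt : ‖u / (r * fourier 1 x)‖ < 1 := by
    rw [norm_div, norm_mul, hw, mul_one, Complex.norm_real, Real.norm_of_nonneg hr.le]
    exact (div_lt_one hr).2 hu
  have h1 : circleCauchyKernel r x u = (r * fourier 1 x)⁻¹ * (1 - u / (r * fourier 1 x))⁻¹ := by
    rw [circleCauchyKernel, ← mul_inv]
    congr 1
    field_simp
  rw [h1]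
  convert! (hasSum_geometric_of_norm_lt_one hlt).mul_left ((r * fourier 1 x)⁻¹) using 2 with n
  rw [fourier_eq_fourier_one_zpow]
  generalize fourier 1 x = w at *
  rw [div_pow, mul_pow, zpow_neg, zpow_neg, mul_inv]
  norm_cast
  push_cast
  rw [pow_succ, pow_succ]
  field_simp

lemma hasSum_circleCauchyKernel_of_lt_norm {r : ℝ} (hr : 0 < r) {u : ℂ} (hu : r < ‖u‖)
    (x : AddCircle (2 * π)) :
    HasSum (fun n : ℕ ↦ (-((r : ℂ) ^ n * u ^ (-((n : ℤ) + 1)))) * fourier (n : ℤ) x)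
      (circleCauchyKernel r x u) := by
  have hw := norm_fourier_apply 1 x
  have hu0 : u ≠ 0 := norm_pos_iff.1 (hr.trans hu)
  have hlt : ‖(r * fourier 1 x) / u‖ < 1 := by
    rw [norm_div, norm_mul, hw, mul_one, Complex.norm_real, Real.norm_of_nonneg hr.le]
    exact (div_lt_one (hr.trans hu)).2 hu
  have h1 : circleCauchyKernel r x u = -u⁻¹ * (1 - (r * fourier 1 x) / u)⁻¹ := by
    rw [circleCauchyKernel, ← inv_neg, ← mul_inv]
    congr 1
    field_simp
    ring
  rw [h1]
  convert! (hasSum_geometric_of_norm_lt_one hlt).mul_left (-u⁻¹) using 2 with n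
  rw [fourier_eq_fourier_one_zpow]
  generalize fourier 1 x = w at *
  rw [div_pow, mul_pow, zpow_neg]
  norm_cast
  rw [pow_succ]
  field_simp

instance : Fact (0 < 2 * π) := ⟨two_pi_pos⟩

lemma summable_norm_of_norm_lt {r : ℝ} {u : ℂ} (hu : ‖u‖ < r) :
    Summable fun n : ℕ ↦ ‖u ^ n * (r : ℂ) ^ (-((n : ℤ) + 1))‖ := by
  simpa [norm_fourier_apply] using (hasSum_circleCauchyKernel_of_norm_lt hu 0).summable.norm

lemma summable_norm_of_lt_norm {r : ℝ} (hr : 0 < r) {u : ℂ} (hu : r < ‖u‖) :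
    Summable fun n : ℕ ↦ ‖-((r : ℂ) ^ n * u ^ (-((n : ℤ) + 1)))‖ := by
  simpa [norm_fourier_apply] using (hasSum_circleCauchyKernel_of_lt_norm hr hu 0).summable.norm

lemma fourierCoeff_circleCauchyKernel_neg {r : ℝ} (hr : 0 < r) {u : ℂ} (hu : ‖u‖ ≠ r) (n : ℕ) :
    fourierCoeff (circleCauchyKernel r · u) (-((n : ℤ) + 1)) =
      (ball (0 : ℂ) r).indicator (fun u ↦ (r : ℂ) ^ (-((n : ℤ) + 1)) * u ^ n) u := by
  rcases lt_or_gt_of_ne hu with h | h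
  · rw [Set.indicator_of_mem (by simpa using h), mul_comm (_ ^ _)]
    exact fourierCoeff_eq_of_hasSum_fourier (e := fun n : ℕ ↦ -((n : ℤ) + 1))
      (fun a b hab ↦ by simpa using hab) (summable_norm_of_norm_lt h)
      (hasSum_circleCauchyKernel_of_norm_lt h) n
  · rw [Set.indicator_of_notMem (by simpa using h.le)]
    exact fourierCoeff_eq_zero_of_hasSum_fourier (summable_norm_of_lt_norm hr h)
      (hasSum_circleCauchyKernel_of_lt_norm hr h) (fun n ↦ by lia)

lemma fourierCoeff_circleCauchyKernel_natCast {r : ℝ} (hr : 0 < r) {u : ℂ} (hu : ‖u‖ ≠ r)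
    (n : ℕ) :
    fourierCoeff (circleCauchyKernel r · u) (n : ℤ) =
      (ball (0 : ℂ) r)ᶜ.indicator (fun u ↦ -(r : ℂ) ^ n * u ^ (-((n : ℤ) + 1))) u := by
  rcases lt_or_gt_of_ne hu with h | h
  · rw [Set.indicator_of_notMem (by simpa using h)]
    exact fourierCoeff_eq_zero_of_hasSum_fourier (summable_norm_of_norm_lt h)
      (hasSum_circleCauchyKernel_of_norm_lt h) (fun n ↦ by lia)
  · rw [Set.indicator_of_mem (by simpa using h.le), neg_mul]
    exact fourierCoeff_eq_of_hasSum_fourier (e := fun n : ℕ ↦ (n : ℤ))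
      Nat.cast_injective (summable_norm_of_lt_norm hr h)
      (hasSum_circleCauchyKernel_of_lt_norm hr h) n

lemma enorm_inv_sub_le (z u : ℂ) :
    ‖(z - u)⁻¹‖ₑ ≤
      ENNReal.ofReal ((1 + ‖u‖)⁻¹) * (ENNReal.ofReal (1 + ‖z‖) * (1 + ‖(z - u)⁻¹‖ₑ)) := by
  rw [← ofReal_norm, ← ENNReal.ofReal_one, ← ENNReal.ofReal_add zero_le_one (norm_nonneg _),
    ← ENNReal.ofReal_mul (by positivity), ← ENNReal.ofReal_mul (by positivity)]
  refine ENNReal.ofReal_le_ofReal ?_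
  rcases eq_or_ne (z - u) 0 with h | h
  · simp only [h, inv_zero, norm_zero]
    positivity
  · have h0 : 0 < ‖z - u‖ := norm_pos_iff.2 h
    have h1 : ‖u‖ ≤ ‖z‖ + ‖z - u‖ := by
      simpa using norm_sub_le z (z - u)
    have hu : 0 < 1 + ‖u‖ := by positivity
    rw [norm_inv]
    have : (1 + ‖u‖)⁻¹ * ((1 + ‖z‖) * (1 + ‖z - u‖⁻¹)) - ‖z - u‖⁻¹ =
        ((1 + ‖z‖) * (‖z - u‖ + 1) - (1 + ‖u‖)) / ((1 + ‖u‖) * ‖z - u‖) := by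
      field_simp
    have h2 : 0 ≤ ((1 + ‖z‖) * (‖z - u‖ + 1) - (1 + ‖u‖)) / ((1 + ‖u‖) * ‖z - u‖) := by
      refine div_nonneg ?_ (by positivity)
      nlinarith [norm_nonneg z, mul_nonneg (norm_nonneg z) h0.le]
    linarith

lemma lintegral_ball_enorm_inv_lt_top : ∫⁻ z in ball (0 : ℂ) 1, ‖z⁻¹‖ₑ < ⊤ := by
  have h : IntegrableOn (fun z : ℂ ↦ z⁻¹) (ball 0 1) := by
    refine integrableOn_ball_of_norm_le_rpow (C := 1) (α := 1) ?_ ?_ ?_ ?_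
    · simp
    · simp
    · exact ae_of_all _ fun z ↦ by simp [Real.rpow_neg_one]
    · exact measurable_inv.aestronglyMeasurable
  exact h.2

lemma lintegral_ball_enorm_inv_sub_le (R : ℝ) (u : ℂ) :
    ∫⁻ z in ball (0 : ℂ) R, ‖(z - u)⁻¹‖ₑ ≤
      volume (ball (0 : ℂ) R) + ∫⁻ z in ball (0 : ℂ) 1, ‖z⁻¹‖ₑ := by
  set g : ℂ → ℝ≥0∞ := (ball (0 : ℂ) 1).indicator fun z ↦ ‖z⁻¹‖ₑ with hg
  have hle (w : ℂ) : ‖w⁻¹‖ₑ ≤ 1 + g w := by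
    by_cases hw : w ∈ ball (0 : ℂ) 1
    · simp [hg, hw]
    · have h1 : 1 ≤ ‖w‖ := by simpa using hw
      refine le_add_right ?_
      rw [← ofReal_norm, ← ENNReal.ofReal_one, norm_inv]
      exact ENNReal.ofReal_le_ofReal (inv_le_one_of_one_le₀ h1)
  calc ∫⁻ z in ball (0 : ℂ) R, ‖(z - u)⁻¹‖ₑ
      ≤ ∫⁻ z in ball (0 : ℂ) R, (1 + g (z - u)) := lintegral_mono fun z ↦ hle _
    _ = volume (ball (0 : ℂ) R) + ∫⁻ z in ball (0 : ℂ) R, g (z - u) := by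
      rw [lintegral_add_left measurable_const]; simp
    _ ≤ volume (ball (0 : ℂ) R) + ∫⁻ z, g (z - u) := by
      gcongr; exact Measure.restrict_le_self
    _ = volume (ball (0 : ℂ) R) + ∫⁻ z in ball (0 : ℂ) 1, ‖z⁻¹‖ₑ := by
      rw [lintegral_sub_right_eq_self, hg, lintegral_indicator measurableSet_ball]

lemma lintegral_ball_lintegral_enorm_inv_sub_lt_top (ω : Measure ℂ) [SigmaFinite ω]
    (h : ∫⁻ u, ENNReal.ofReal ((1 + ‖u‖)⁻¹) ∂ω < ⊤) (R : ℝ) :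
    ∫⁻ z in ball (0 : ℂ) R, ∫⁻ u, ‖(z - u)⁻¹‖ₑ ∂ω < ⊤ := by
  set V := volume (ball (0 : ℂ) R)
  set J := ∫⁻ z in ball (0 : ℂ) 1, ‖z⁻¹‖ₑ
  rw [lintegral_lintegral_swap (by fun_prop)]
  have hbound (u : ℂ) : ∫⁻ z in ball (0 : ℂ) R, ‖(z - u)⁻¹‖ₑ ≤
      ENNReal.ofReal ((1 + ‖u‖)⁻¹) * (ENNReal.ofReal (1 + R) * (V + (V + J))) := by
    calc ∫⁻ z in ball (0 : ℂ) R, ‖(z - u)⁻¹‖ₑ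
        ≤ ∫⁻ z in ball (0 : ℂ) R, ENNReal.ofReal ((1 + ‖u‖)⁻¹) *
            (ENNReal.ofReal (1 + R) * (1 + ‖(z - u)⁻¹‖ₑ)) := by
          refine setLIntegral_mono' measurableSet_ball fun z hz ↦ ?_
          refine (enorm_inv_sub_le z u).trans ?_
          have : ‖z‖ ≤ R := by simpa using (mem_ball.1 hz).le
          gcongr
      _ = ENNReal.ofReal ((1 + ‖u‖)⁻¹) * (ENNReal.ofReal (1 + R) *
            (V + ∫⁻ z in ball (0 : ℂ) R, ‖(z - u)⁻¹‖ₑ)) := by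
          rw [lintegral_const_mul _ (by fun_prop), lintegral_const_mul _ (by fun_prop),
            lintegral_add_left measurable_const]
          simp [V]
      _ ≤ _ := by gcongr; exact lintegral_ball_enorm_inv_sub_le R u
  refine (lintegral_mono hbound).trans_lt ?_
  rw [lintegral_mul_const _ (by fun_prop)]
  have hV : V < ⊤ := measure_ball_lt_top
  have hJ : J < ⊤ := lintegral_ball_enorm_inv_lt_top
  finiteness

lemma ae_lintegral_circle_lt_top_of_ball {F : ℂ → ℝ≥0∞} (hF : Measurable F)
    (h : ∀ R, ∫⁻ z in ball (0 : ℂ) R, F z < ⊤) :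
    ∀ᵐ r : ℝ ∂volume.restrict (Set.Ioi 0),
      ∫⁻ θ in Set.Ioo (-π) π, F (r * Complex.exp (θ * Complex.I)) < ⊤ := by
  have key (N : ℕ) : ∀ᵐ r : ℝ ∂volume.restrict (Set.Ioi 0), r < N →
      ∫⁻ θ in Set.Ioo (-π) π, F (r * Complex.exp (θ * Complex.I)) < ⊤ := by
    set G := (ball (0 : ℂ) N).indicator F
    have hG : Measurable G := hF.indicator measurableSet_ball
    have h1 : ∫⁻ z, G z < ⊤ := by
      rw [lintegral_indicator measurableSet_ball]; exact h N
    have hm : Measurable fun p : ℝ × ℝ ↦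
        ENNReal.ofReal p.1 * G (p.1 * Complex.exp (p.2 * Complex.I)) := by fun_prop
    have h2 : ∫⁻ r in Set.Ioi (0 : ℝ), ∫⁻ θ in Set.Ioo (-π) π,
        ENNReal.ofReal r * G (r * Complex.exp (θ * Complex.I)) < ⊤ := by
      rw [← Complex.lintegral_comp_polarCoord_symm, polarCoord_target,
        Measure.volume_eq_prod, ← Measure.prod_restrict] at h1
      refine lt_of_eq_of_lt ?_ h1
      rw [← lintegral_prod _ hm.aemeasurable]
      simp [Complex.exp_mul_I]
    filter_upwards [ae_lt_top hm.lintegral_prod_right' h2.ne,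
      ae_restrict_mem measurableSet_Ioi] with r hr hr0 hrN
    rw [lintegral_const_mul _ (by fun_prop)] at hr
    have hr0' : (0 : ℝ) < r := hr0
    have hball (θ : ℝ) : (r : ℂ) * Complex.exp (θ * Complex.I) ∈ ball (0 : ℂ) N := by
      simpa [Complex.norm_exp_ofReal_mul_I, abs_of_pos hr0'] using hrN
    simp only [G, Set.indicator_of_mem (hball _)] at hr
    exact ENNReal.lt_top_of_mul_ne_top_right hr.ne (by simpa using hr0')
  filter_upwards [ae_all_iff.2 key] with r hr
  obtain ⟨N, hN⟩ := exists_nat_gt r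
  exact hr N hN

lemma fourier_one_coe (θ : ℝ) :
    fourier 1 (θ : AddCircle (2 * π)) = Complex.exp (θ * Complex.I) := by
  rw [fourier_coe_apply]
  congr 1
  have : (π : ℂ) ≠ 0 := by exact_mod_cast pi_ne_zero
  push_cast
  field_simp

@[fun_prop]
lemma measurable_circleCauchyKernel (r : ℝ) :
    Measurable (Function.uncurry (circleCauchyKernel r)) := by
  unfold circleCauchyKernel Function.uncurry
  have : Measurable fun x : AddCircle (2 * π) ↦ fourier 1 x :=
    (map_continuous (fourier 1)).measurable
  fun_prop

lemma ae_integrable_circleCauchyKernel (ω : Measure ℂ) [SigmaFinite ω]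
    (h : ∫⁻ u, ENNReal.ofReal ((1 + ‖u‖)⁻¹) ∂ω < ⊤) :
    ∀ᵐ r : ℝ ∂volume.restrict (Set.Ioi 0),
      Integrable (Function.uncurry (circleCauchyKernel r))
        (AddCircle.haarAddCircle.prod ω) := by
  have hF : Measurable fun z : ℂ ↦ ∫⁻ u, ‖(z - u)⁻¹‖ₑ ∂ω :=
    Measurable.lintegral_prod_right' (f := fun p : ℂ × ℂ ↦ ‖(p.1 - p.2)⁻¹‖ₑ) (by fun_prop)
  filter_upwards [ae_lintegral_circle_lt_top_of_ball hF
    (lintegral_ball_lintegral_enorm_inv_sub_lt_top ω h)] with r hr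
  refine ⟨(measurable_circleCauchyKernel r).aestronglyMeasurable, ?_⟩
  have h1 : ∫⁻ x : AddCircle (2 * π), ∫⁻ u, ‖circleCauchyKernel r x u‖ₑ ∂ω < ⊤ := by
    rw [← AddCircle.lintegral_preimage (2 * π) (-π), show -π + 2 * π = π by ring,
      ← restrict_Ioo_eq_restrict_Ioc]
    simpa only [circleCauchyKernel, fourier_one_coe] using hr
  rw [AddCircle.volume_eq_smul_haarAddCircle, lintegral_smul_measure] at h1
  rw [hasFiniteIntegral_iff_enorm, lintegral_prod _ (by fun_prop)]
  exact ENNReal.lt_top_of_mul_ne_top_right h1.ne (by simp [pi_pos])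

lemma ae_measure_norm_eq_zero (ω : Measure ℂ) [SigmaFinite ω] :
    ∀ᵐ r : ℝ, ∀ᵐ u ∂ω, ‖u‖ ≠ r := by
  have h := (Measure.countable_meas_level_set_pos (μ := ω) measurable_norm).ae_notMem volume
  filter_upwards [h] with r hr
  simpa [ae_iff] using hr

/-- The Cauchy transform `∫ dω(u) / (z - u)` on the circle of radius `r`, in the angular
variable. -/
noncomputable def circleCauchyTransform (ω : Measure ℂ) (r : ℝ) (x : AddCircle (2 * π)) : ℂ :=
  ∫ u, circleCauchyKernel r x u ∂ω

lemma fourierCoeff_circleCauchyTransform {ω : Measure ℂ} [SigmaFinite ω] {r : ℝ}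
    (h : Integrable (Function.uncurry (circleCauchyKernel r)) (AddCircle.haarAddCircle.prod ω))
    (n : ℤ) :
    fourierCoeff (circleCauchyTransform ω r) n =
      ∫ u, fourierCoeff (circleCauchyKernel r · u) n ∂ω := by
  have hint : Integrable (Function.uncurry fun x u ↦ fourier (-n) x * circleCauchyKernel r x u)
      (AddCircle.haarAddCircle.prod ω) := by
    refine h.bdd_mul (c := 1) (Continuous.aestronglyMeasurable ?_)
      (Eventually.of_forall fun p ↦ (norm_fourier_apply (-n) p.1).le)
    exact (map_continuous (fourier (-n))).comp continuous_fst
  simp only [fourierCoeff, smul_eq_mul, circleCauchyTransform, ← integral_const_mul]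
  exact integral_integral_swap hint

lemma fourierCoeff_circleCauchyTransform_neg {ω : Measure ℂ} [SigmaFinite ω] {r : ℝ} (hr : 0 < r)
    (h : Integrable (Function.uncurry (circleCauchyKernel r)) (AddCircle.haarAddCircle.prod ω))
    (h0 : ∀ᵐ u ∂ω, ‖u‖ ≠ r) (n : ℕ) :
    fourierCoeff (circleCauchyTransform ω r) (-((n : ℤ) + 1)) =
      (r : ℂ) ^ (-((n : ℤ) + 1)) * innerMoment ω r n := by
  rw [fourierCoeff_circleCauchyTransform h, innerMoment, ← integral_const_mul,
    ← integral_indicator measurableSet_ball]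
  refine integral_congr_ae ?_
  filter_upwards [h0] with u hu using fourierCoeff_circleCauchyKernel_neg hr hu n

lemma fourierCoeff_circleCauchyTransform_natCast {ω : Measure ℂ} [SigmaFinite ω] {r : ℝ}
    (hr : 0 < r)
    (h : Integrable (Function.uncurry (circleCauchyKernel r)) (AddCircle.haarAddCircle.prod ω))
    (h0 : ∀ᵐ u ∂ω, ‖u‖ ≠ r) (n : ℕ) :
    fourierCoeff (circleCauchyTransform ω r) (n : ℤ) =
      -(r : ℂ) ^ n * outerMoment ω r (n + 1) := by
  rw [fourierCoeff_circleCauchyTransform h, outerMoment, ← integral_const_mul,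
    ← integral_indicator measurableSet_ball.compl]
  refine integral_congr_ae ?_
  filter_upwards [h0] with u hu
  simpa using fourierCoeff_circleCauchyKernel_natCast hr hu n

open scoped ComplexConjugate in
lemma biotSavart_eq_conj_integral_inv (ω : Measure ℂ) (z : ℂ) :
    biotSavart ω z = (2 * π)⁻¹ • (Complex.I * conj (∫ u, (z - u)⁻¹ ∂ω)) := by
  rw [biotSavart, ← integral_conj, ← integral_const_mul]
  congr 2 with u
  rw [mul_div_assoc, Complex.inv_def, map_mul, Complex.conj_conj, Complex.conj_ofReal,
    Complex.normSq_eq_norm_sq, div_eq_mul_inv]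
  push_cast
  ring

lemma enorm_sq_biotSavart_sub (ω₁ ω₂ : Measure ℂ) (r θ : ℝ) :
    ENNReal.ofReal (4 * π ^ 2) * ‖biotSavart ω₁ (r * Complex.exp (θ * Complex.I)) -
        biotSavart ω₂ (r * Complex.exp (θ * Complex.I))‖ₑ ^ 2 =
      ‖circleCauchyTransform ω₁ r θ - circleCauchyTransform ω₂ r θ‖ₑ ^ 2 := by
  simp only [biotSavart_eq_conj_integral_inv, ← smul_sub, ← mul_sub, ← map_sub,
    circleCauchyTransform, circleCauchyKernel, fourier_one_coe]
  rw [← ofReal_norm, ← ofReal_norm, ← ENNReal.ofReal_pow (norm_nonneg _),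
    ← ENNReal.ofReal_pow (norm_nonneg _), ← ENNReal.ofReal_mul (by positivity), norm_smul,
    norm_mul, Complex.norm_I, RCLike.norm_conj, Real.norm_of_nonneg (by positivity)]
  congr 1
  field_simp
  ring

/-- Corollary 3.8: moment representation for the difference of two vorticities
(the "signed" version of the moment formula), for a.e. `r > 0`. -/
theorem stmt11 (ω₁ ω₂ : Measure ℂ) [SigmaFinite ω₁] [SigmaFinite ω₂]
    (h₁ : ∫⁻ u, ENNReal.ofReal ((1 + ‖u‖)⁻¹) ∂ω₁ < ⊤)
    (h₂ : ∫⁻ u, ENNReal.ofReal ((1 + ‖u‖)⁻¹) ∂ω₂ < ⊤) :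
    ∀ᵐ (r : ℝ) ∂(volume.restrict (Set.Ioi (0 : ℝ))),
      ENNReal.ofReal (4 * π ^ 2) *
        ((ENNReal.ofReal (2 * π))⁻¹ *
          ∫⁻ θ in Set.Ioo (0 : ℝ) (2 * π),
            (‖biotSavart ω₁ ((r : ℂ) * Complex.exp ((θ : ℂ) * Complex.I)) -
              biotSavart ω₂ ((r : ℂ) * Complex.exp ((θ : ℂ) * Complex.I))‖₊ : ℝ≥0∞) ^ 2) =
        (∑' n : ℕ,
          ENNReal.ofReal (r ^ (-2 * (n : ℤ) - 2) *
            ‖innerMoment ω₁ r n - innerMoment ω₂ r n‖ ^ 2)) +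
        ∑' k : ℕ,
          ENNReal.ofReal (r ^ (2 * ((k : ℤ) + 1) - 2) *
            ‖outerMoment ω₁ r (k + 1) - outerMoment ω₂ r (k + 1)‖ ^ 2) := by
  filter_upwards [ae_integrable_circleCauchyKernel ω₁ h₁, ae_integrable_circleCauchyKernel ω₂ h₂,
    ae_restrict_of_ae (ae_measure_norm_eq_zero ω₁), ae_restrict_of_ae (ae_measure_norm_eq_zero ω₂),
    ae_restrict_mem measurableSet_Ioi] with r hi₁ hi₂ hz₁ hz₂ hr
  replace hr : 0 < r := hr
  set f := circleCauchyTransform ω₁ r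
  set g := circleCauchyTransform ω₂ r
  have hf : Integrable f AddCircle.haarAddCircle := hi₁.integral_prod_left
  have hg : Integrable g AddCircle.haarAddCircle := hi₂.integral_prod_left
  have hcoeff (n : ℤ) : fourierCoeff (f - g) n = fourierCoeff f n - fourierCoeff g n := by
    have h := congrArg (· n) (fourierCoeff.add (hf.sub hg) hg)
    simp only [sub_add_cancel, Pi.add_apply] at h
    rw [h, add_sub_cancel_right]
  have hlhs : ENNReal.ofReal (4 * π ^ 2) *
        ((ENNReal.ofReal (2 * π))⁻¹ *
          ∫⁻ θ in Set.Ioo (0 : ℝ) (2 * π),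
            (‖biotSavart ω₁ ((r : ℂ) * Complex.exp ((θ : ℂ) * Complex.I)) -
              biotSavart ω₂ ((r : ℂ) * Complex.exp ((θ : ℂ) * Complex.I))‖₊ : ℝ≥0∞) ^ 2) =
      ∫⁻ x, ‖(f - g) x‖ₑ ^ 2 ∂AddCircle.haarAddCircle := by
    rw [mul_left_comm, ← lintegral_const_mul' _ _ ENNReal.ofReal_ne_top]
    simp only [← enorm_eq_nnnorm, enorm_sq_biotSavart_sub]
    have h := AddCircle.lintegral_preimage (2 * π) 0 (fun x ↦ ‖(f - g) x‖ₑ ^ 2)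
    rw [zero_add, ← restrict_Ioo_eq_restrict_Ioc, AddCircle.volume_eq_smul_haarAddCircle,
      lintegral_smul_measure] at h
    simp only [Pi.sub_apply] at h ⊢
    rw [h, smul_eq_mul, ← mul_assoc, ENNReal.inv_mul_cancel (by simp [pi_pos]) ENNReal.ofReal_ne_top,
      one_mul]
  rw [hlhs, lintegral_enorm_sq_eq_tsum_fourierCoeff (hf.sub hg),
    tsum_of_nat_of_neg_add_one ENNReal.summable ENNReal.summable, add_comm]
  simp only [hcoeff, f, g, fourierCoeff_circleCauchyTransform_neg hr hi₁ hz₁,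
    fourierCoeff_circleCauchyTransform_neg hr hi₂ hz₂,
    fourierCoeff_circleCauchyTransform_natCast hr hi₁ hz₁,
    fourierCoeff_circleCauchyTransform_natCast hr hi₂ hz₂, ← mul_sub]
  congr 1 <;> congr 1 with n <;>
    rw [← ofReal_norm, ← ENNReal.ofReal_pow (norm_nonneg _), norm_mul, mul_pow] <;> congr 2
  · rw [norm_zpow, Complex.norm_real, Real.norm_of_nonneg hr.le, ← zpow_natCast, ← zpow_mul]
    congr 1
    push_cast
    ring
  · rw [norm_neg, norm_pow, Complex.norm_real, Real.norm_of_nonneg hr.le, ← pow_mul, ← zpow_natCast]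
    congr 1
    push_cast
    ring
end

section
/- Let ω be a nonnegative σ-finite measure on ℂ satisfying ω(B(0,r)) = c·r^α for every r > 0, with c > 0 and α ∈ (0,1). Then for every r > 0: |m_{r,n}(ω)| ≤ c·(α/(n+α))·r^{n+α} for all integers n ≥ 0, and |M_{r,k}(ω)| ≤ c·(α/(k−α))·r^{−k+α} for all integers k ≥ 1. -/
open MeasureTheory Metric Real Filter
open scoped ENNReal NNReal Topology

/-- A measure on `ℂ` with `ω (B(0,s)) = c s ^ α` has radial distribution `c α s ^ (α - 1) ds`. -/
theorem map_norm_eq_withDensity_of_ball_eq {ω : Measure ℂ} {c α : ℝ} (hc : 0 < c) (hα : 0 < α)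
    (hω : ∀ r > (0 : ℝ), ω (ball (0 : ℂ) r) = ENNReal.ofReal (c * r ^ α)) :
    ω.map norm = (volume.restrict (Set.Ioi (0 : ℝ))).withDensity
      (fun s => ENNReal.ofReal (c * α * s ^ (α - 1))) := by
  set ν := (volume.restrict (Set.Ioi (0 : ℝ))).withDensity
      (fun s => ENNReal.ofReal (c * α * s ^ (α - 1))) with hν
  have hmap : ∀ x, ω.map norm (Set.Iio x) = ω (ball (0 : ℂ) x) := fun x => by
    rw [Measure.map_apply measurable_norm measurableSet_Iio]
    congr 1
    ext u
    simp
  have hfin : ∀ x, ω.map norm (Set.Iio x) ≠ ∞ := fun x => by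
    rw [hmap]
    rcases le_or_gt x 0 with hx | hx
    · simp [ball_eq_empty.2 hx]
    · simp [hω x hx]
  have hIio : ∀ x, ω.map norm (Set.Iio x) = ν (Set.Iio x) := fun x => by
    rw [hmap, hν, withDensity_apply _ measurableSet_Iio,
      Measure.restrict_restrict measurableSet_Iio, Set.inter_comm, Set.Ioi_inter_Iio]
    rcases le_or_gt x 0 with hx | hx
    · simp [ball_eq_empty.2 hx, Set.Ioo_eq_empty_of_le hx]
    have hint : IntervalIntegrable (fun s : ℝ => c * α * s ^ (α - 1)) volume 0 x :=
      (intervalIntegral.intervalIntegrable_rpow' (by linarith)).const_mul _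
    rw [hω x hx, ← ofReal_integral_eq_lintegral_ofReal]
    · rw [← integral_Ioc_eq_integral_Ioo, ← intervalIntegral.integral_of_le hx.le,
        intervalIntegral.integral_const_mul, integral_rpow (Or.inl (by linarith))]
      congr 1
      simp only [sub_add_cancel, Real.zero_rpow hα.ne', sub_zero]
      field_simp
    · exact ((intervalIntegrable_iff_integrableOn_Ioc_of_le hx.le).1 hint).mono_set
        Set.Ioo_subset_Ioc_self
    · filter_upwards [ae_restrict_mem measurableSet_Ioo] with s hs
      have := hs.1
      positivity
  refine Measure.ext_of_Ico' _ _ (fun a b _ => ?_) (fun a b hab => ?_)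
  · exact ne_top_of_le_ne_top (hfin b) (measure_mono fun _ h => h.2)
  · have hsub : Set.Iio a ⊆ Set.Iio b := Set.Iio_subset_Iio hab.le
    have hdiff : Set.Ico a b = Set.Iio b \ Set.Iio a := by
      ext; simp
    rw [hdiff, measure_sdiff hsub measurableSet_Iio.nullMeasurableSet (hfin a),
      measure_sdiff hsub measurableSet_Iio.nullMeasurableSet (hIio a ▸ hfin a), hIio, hIio]

/-- Integration in polar coordinates bounds the integral of `u ^ p` over a radial set. -/
theorem norm_setIntegral_zpow_le_of_ball_eq {ω : Measure ℂ} {c α : ℝ} (hc : 0 < c) (hα : 0 < α)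
    (hω : ∀ r > (0 : ℝ), ω (ball (0 : ℂ) r) = ENNReal.ofReal (c * r ^ α))
    {S : Set ℝ} (hS : MeasurableSet S) (p : ℤ) :
    ‖∫ u in norm ⁻¹' S, u ^ p ∂ω‖ ≤ c * α * ∫ s in S ∩ Set.Ioi 0, s ^ ((p : ℝ) + α - 1) := by
  refine (norm_integral_le_integral_norm _).trans_eq ?_
  have hmeas : Measurable fun s : ℝ => ENNReal.ofReal (c * α * s ^ (α - 1)) := by fun_prop
  calc ∫ u in norm ⁻¹' S, ‖u ^ p‖ ∂ω = ∫ s in S, s ^ p ∂(ω.map norm) := by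
        rw [setIntegral_map hS (by fun_prop) (by fun_prop)]
        simp
    _ = c * α * ∫ s in S ∩ Set.Ioi 0, s ^ ((p : ℝ) + α - 1) := by
        rw [map_norm_eq_withDensity_of_ball_eq hc hα hω, restrict_withDensity hS,
          Measure.restrict_restrict hS,
          integral_withDensity_eq_integral_toReal_smul hmeas (by simp), ← integral_const_mul]
        refine setIntegral_congr_fun (hS.inter measurableSet_Ioi) fun s hs => ?_
        have hs0 : 0 < s := hs.2
        have hnn : 0 ≤ c * α * s ^ (α - 1) := by positivity
        simp only [ENNReal.toReal_ofReal hnn, smul_eq_mul]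
        rw [add_sub_assoc, Real.rpow_add hs0, Real.rpow_intCast]
        ring

/-- The moment estimates (3.4)-(3.5): bounds on inner and outer moments under the
growth condition. -/
theorem stmt12 (ω : Measure ℂ) [SigmaFinite ω] (c α : ℝ) (hc : 0 < c)
    (hα : α ∈ Set.Ioo (0 : ℝ) 1)
    (hω : ∀ r > (0 : ℝ), ω (ball (0 : ℂ) r) = ENNReal.ofReal (c * r ^ α))
    (r : ℝ) (hr : 0 < r) :
    (∀ n : ℕ, ‖innerMoment ω r n‖ ≤ c * (α / (n + α)) * r ^ ((n : ℝ) + α)) ∧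
    (∀ k : ℕ, 1 ≤ k → ‖outerMoment ω r k‖ ≤ c * (α / (k - α)) * r ^ (-(k : ℝ) + α)) := by
  constructor
  · intro n
    have hball : ball (0 : ℂ) r = norm ⁻¹' Set.Iio r := by ext; simp
    have h := norm_setIntegral_zpow_le_of_ball_eq hc hα.1 hω (measurableSet_Iio (a := r)) n
    have hpos : 0 < (n : ℝ) + α := by have := hα.1; positivity
    rw [Set.inter_comm, Set.Ioi_inter_Iio, ← integral_Ioc_eq_integral_Ioo,
      ← intervalIntegral.integral_of_le hr.le, Int.cast_natCast,
      integral_rpow (Or.inl (by linarith)), sub_add_cancel, Real.zero_rpow hpos.ne',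
      sub_zero] at h
    simp only [zpow_natCast] at h
    rw [innerMoment, hball]
    exact h.trans_eq (by ring)
  · intro k hk
    have hcompl : (ball (0 : ℂ) r)ᶜ = norm ⁻¹' Set.Ici r := by ext; simp
    have h := norm_setIntegral_zpow_le_of_ball_eq hc hα.1 hω (measurableSet_Ici (a := r)) (-k)
    have hk1 : (1 : ℝ) ≤ k := by exact_mod_cast hk
    rw [Set.inter_eq_left.2 (Set.Ici_subset_Ioi.2 hr), integral_Ici_eq_integral_Ioi,
      Int.cast_neg, Int.cast_natCast,
      integral_Ioi_rpow_of_lt (by linarith [hα.2]) hr, sub_add_cancel] at h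
    rw [outerMoment, hcompl]
    refine h.trans_eq ?_
    rw [neg_div, ← div_neg, neg_add, neg_neg, ← sub_eq_add_neg]
    ring
end

section
/- Fix c > 0 and α ∈ (0,1), and let ω_∞ be the measure on ℂ with density dω_∞(z) = (cα/(2π))·|z|^{α−2} dz with respect to two-dimensional Lebesgue measure, and ω₀ the measure on ℂ supported on the positive real half-line given by dω₀(x) = cα·x^{α−1} dx on (0,∞). Then for every r > 0: E_r(ω_∞) = (c²/(4πα))·r^{2α} and E_r(ω₀) = (c²·α·π/(4·sin²(πα)))·r^{2α}. In particular, both bounds in the inequality (c²/(4πα))·r^{2α} ≤ E_r(ω) ≤ (c²·α·π/(4·sin²(πα)))·r^{2α}, valid for all nonnegative σ-finite measures ω with ω(B(0,r)) = c·r^α for all r > 0, are attained. -/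
open MeasureTheory Metric Real Filter
open scoped ENNReal NNReal Topology

theorem lintegral_Ioo_rpow {p r K : ℝ} (hp : -1 < p) (hK : 0 ≤ K) (hr : 0 < r) :
    ∫⁻ x in Set.Ioo 0 r, ENNReal.ofReal (K * x ^ p) =
      ENNReal.ofReal (K * (r ^ (p + 1) / (p + 1))) := by
  have h_int : IntegrableOn (fun x : ℝ => K * x ^ p) (Set.Ioo 0 r) :=
    (((intervalIntegral.intervalIntegrable_rpow' (a := 0) (b := r) hp).1.mono_set
      Set.Ioo_subset_Ioc_self).const_mul K)
  rw [← ofReal_integral_eq_lintegral_ofReal h_int]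
  · rw [integral_const_mul, ← integral_Ioc_eq_integral_Ioo,
      ← intervalIntegral.integral_of_le hr.le, integral_rpow (Or.inl hp),
      Real.zero_rpow (by linarith), sub_zero]
  · filter_upwards [ae_restrict_mem measurableSet_Ioo] with x hx
    exact mul_nonneg hK (Real.rpow_nonneg hx.1.le _)

theorem lintegral_ball_norm_rpow {p r K : ℝ} (hp : -2 < p) (hK : 0 ≤ K) (hr : 0 < r) :
    ∫⁻ z in ball (0 : ℂ) r, ENNReal.ofReal (K * ‖z‖ ^ p) =
      ENNReal.ofReal (2 * π * K * (r ^ (p + 2) / (p + 2))) := by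
  rw [← lintegral_indicator measurableSet_ball, ← Complex.lintegral_comp_polarCoord_symm]
  have hcongr : ∀ q ∈ polarCoord.target,
      ENNReal.ofReal q.1 • (ball (0 : ℂ) r).indicator (fun z => ENNReal.ofReal (K * ‖z‖ ^ p))
          (Complex.polarCoord.symm q) =
        (Set.Iio r).indicator (fun x => ENNReal.ofReal (K * x ^ (p + 1))) q.1 * 1 := by
    rintro ⟨x, θ⟩ ⟨hx, -⟩
    have hx : 0 < x := hx
    have hn : ‖Complex.polarCoord.symm (x, θ)‖ = x := by
      rw [Complex.norm_polarCoord_symm, abs_of_pos hx]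
    by_cases h : x < r
    · rw [Set.indicator_of_mem (by rw [mem_ball_zero_iff, hn]; exact h),
        Set.indicator_of_mem (by exact h), hn, smul_eq_mul, ← ENNReal.ofReal_mul hx.le, mul_one, Real.rpow_add_one hx.ne']
      congr 1
      ring
    · rw [Set.indicator_of_notMem (by rw [mem_ball_zero_iff, hn]; exact h),
        Set.indicator_of_notMem (by exact h)]
      simp
  have hpow : Measurable fun x : ℝ => ENNReal.ofReal (K * x ^ (p + 1)) := by fun_prop
  rw [setLIntegral_congr_fun polarCoord.open_target.measurableSet hcongr, polarCoord_target,
    Measure.volume_eq_prod, ← Measure.prod_restrict,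
    lintegral_prod_mul (hpow.indicator measurableSet_Iio).aemeasurable aemeasurable_const,
    lintegral_indicator measurableSet_Iio, Measure.restrict_restrict measurableSet_Iio,
    Set.inter_comm, Set.Ioi_inter_Iio, lintegral_Ioo_rpow (by linarith) hK hr]
  simp only [lintegral_const, Measure.restrict_apply_univ, Real.volume_Ioo, one_mul]
  rw [← ENNReal.ofReal_mul' (by linarith [Real.pi_pos])]
  congr 1
  rw [show p + 1 + 1 = p + 2 by ring]
  ring

theorem div_norm_sq_eq_conj_inv (w : ℂ) :
    w / ((‖w‖ : ℝ) : ℂ) ^ 2 = (starRingEnd ℂ) w⁻¹ := by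
  rw [Complex.inv_def, map_mul, Complex.conj_conj, Complex.conj_ofReal, Complex.normSq_eq_norm_sq]
  push_cast
  rfl

theorem norm_biotSavart (ω : Measure ℂ) (z : ℂ) :
    ‖biotSavart ω z‖ = (2 * π)⁻¹ * ‖∫ u, (z - u)⁻¹ ∂ω‖ := by
  have h : ∀ u : ℂ, Complex.I * (z - u) / (((‖z - u‖ : ℝ) : ℂ) ^ 2) =
      Complex.I * (starRingEnd ℂ) (z - u)⁻¹ := fun u => by
    rw [mul_div_assoc, div_norm_sq_eq_conj_inv]
  rw [biotSavart, norm_smul]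
  simp_rw [h]
  rw [integral_const_mul, integral_conj, norm_mul, Complex.norm_I, one_mul, RCLike.norm_conj,
    Real.norm_of_nonneg (by positivity)]

theorem localEnergy_of_norm_cauchy_eq {ω : Measure ℂ} {A α r : ℝ} (hα : 0 < α)
    (hr : 0 < r) (h : ∀ᵐ z : ℂ, ‖∫ u, (z - u)⁻¹ ∂ω‖ = A * ‖z‖ ^ (α - 1)) :
    localEnergy ω r = ENNReal.ofReal (A ^ 2 / (4 * π * α) * r ^ (2 * α)) := by
  have key : ∀ᵐ z : ℂ ∂volume.restrict (ball 0 r), (‖biotSavart ω z‖₊ : ℝ≥0∞) ^ 2 =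
      ENNReal.ofReal ((A / (2 * π)) ^ 2 * ‖z‖ ^ (2 * α - 2)) := by
    filter_upwards [ae_restrict_of_ae h] with z hz
    rw [← enorm_eq_nnnorm, ← ofReal_norm, ← ENNReal.ofReal_pow (norm_nonneg _),
      norm_biotSavart, hz, show 2 * α - 2 = (α - 1) * (2 : ℕ) by push_cast; ring,
      Real.rpow_mul_natCast (norm_nonneg _)]
    congr 1
    ring
  rw [localEnergy, lintegral_congr_ae key,
    lintegral_ball_norm_rpow (by linarith) (by positivity) hr, sub_add_cancel]
  congr 1
  field_simp
  ring

theorem sin_pi_mul_pos {α : ℝ} (hα : α ∈ Set.Ioo (0 : ℝ) 1) : 0 < Real.sin (π * α) :=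
  Real.sin_pos_of_pos_of_lt_pi (mul_pos Real.pi_pos hα.1)
    (mul_lt_of_lt_one_right Real.pi_pos hα.2)

theorem lintegral_rpow_mul_exp_neg_mul {a s : ℝ} (ha : 0 < a) (hs : 0 < s) :
    ∫⁻ x in Set.Ioi (0 : ℝ), ENNReal.ofReal (x ^ (a - 1) * Real.exp (-(s * x))) =
      ENNReal.ofReal ((1 / s) ^ a * Real.Gamma a) := by
  have h := Real.integral_rpow_mul_exp_neg_mul_Ioi ha hs
  have hpos : 0 < (1 / s) ^ a * Real.Gamma a := mul_pos (by positivity) (Real.Gamma_pos_of_pos ha)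
  rw [← h, ofReal_integral_eq_lintegral_ofReal]
  · exact Integrable.of_integral_ne_zero (by rw [h]; exact hpos.ne')
  · filter_upwards [ae_restrict_mem measurableSet_Ioi] with x hx
    have hx : 0 < x := hx
    positivity

theorem lintegral_rpow_div_add {α a : ℝ} (hα : α ∈ Set.Ioo (0 : ℝ) 1) (ha : 0 < a) :
    ∫⁻ x in Set.Ioi (0 : ℝ), ENNReal.ofReal (x ^ (α - 1) / (x + a)) =
      ENNReal.ofReal (π / Real.sin (π * α) * a ^ (α - 1)) := by
  have hα0 := hα.1
  have hα1 : 0 < 1 - α := by linarith [hα.2]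
  have h1 : ∀ x ∈ Set.Ioi (0 : ℝ), ENNReal.ofReal (x ^ (α - 1) / (x + a)) =
      ∫⁻ s in Set.Ioi (0 : ℝ), ENNReal.ofReal (x ^ (α - 1) * Real.exp (-((x + a) * s))) := by
    intro x hx
    have hx : 0 < x := hx
    have := lintegral_rpow_mul_exp_neg_mul one_pos (add_pos hx ha)
    simp only [sub_self, Real.rpow_zero, one_mul, Real.rpow_one, Real.Gamma_one, mul_one] at this
    simp_rw [ENNReal.ofReal_mul (Real.rpow_nonneg hx.le (α - 1))]
    rw [lintegral_const_mul _ (by fun_prop), this, ← ENNReal.ofReal_mul (by positivity),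
      mul_one_div]
  have h2 : ∀ s ∈ Set.Ioi (0 : ℝ),
      ∫⁻ x in Set.Ioi (0 : ℝ), ENNReal.ofReal (x ^ (α - 1) * Real.exp (-((x + a) * s))) =
      ENNReal.ofReal (Real.Gamma α) *
        ENNReal.ofReal (s ^ ((1 - α) - 1) * Real.exp (-(a * s))) := by
    intro s hs
    have hs : 0 < s := hs
    have h : ∀ x, ENNReal.ofReal (x ^ (α - 1) * Real.exp (-((x + a) * s))) =
        ENNReal.ofReal (Real.exp (-(a * s))) *
          ENNReal.ofReal (x ^ (α - 1) * Real.exp (-(s * x))) := by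
      intro x
      rw [← ENNReal.ofReal_mul (Real.exp_pos _).le, mul_left_comm, ← Real.exp_add]
      ring_nf
    simp_rw [h]
    rw [lintegral_const_mul _ (by fun_prop), lintegral_rpow_mul_exp_neg_mul hα0 hs,
      ← ENNReal.ofReal_mul (Real.exp_pos _).le, ← ENNReal.ofReal_mul (Real.Gamma_pos_of_pos hα0).le,
      one_div, Real.inv_rpow hs.le, ← Real.rpow_neg hs.le, show 1 - α - 1 = -α by ring]
    ring_nf
  rw [setLIntegral_congr_fun measurableSet_Ioi h1, lintegral_lintegral_swap (by fun_prop),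
    setLIntegral_congr_fun measurableSet_Ioi h2, lintegral_const_mul _ (by fun_prop),
    lintegral_rpow_mul_exp_neg_mul hα1 ha, ← ENNReal.ofReal_mul (Real.Gamma_pos_of_pos hα0).le,
    ← Real.Gamma_mul_Gamma_one_sub, one_div, Real.inv_rpow ha.le, ← Real.rpow_neg ha.le, neg_sub]
  ring_nf

theorem integrableOn_rpow_div_add {α a : ℝ} (hα : α ∈ Set.Ioo (0 : ℝ) 1) (ha : 0 < a) :
    IntegrableOn (fun x : ℝ => x ^ (α - 1) / (x + a)) (Set.Ioi 0) := by
  refine ⟨Measurable.aestronglyMeasurable (by fun_prop), ?_⟩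
  rw [hasFiniteIntegral_iff_ofReal, lintegral_rpow_div_add hα ha]
  · exact ENNReal.ofReal_lt_top
  · filter_upwards [ae_restrict_mem measurableSet_Ioi] with x hx
    have hx : 0 < x := hx
    change 0 ≤ x ^ (α - 1) / (x + a)
    positivity

theorem integral_rpow_div_add {α a : ℝ} (hα : α ∈ Set.Ioo (0 : ℝ) 1) (ha : 0 < a) :
    ∫ x in Set.Ioi (0 : ℝ), x ^ (α - 1) / (x + a) = π / Real.sin (π * α) * a ^ (α - 1) := by
  have hsin := sin_pi_mul_pos hα
  rw [integral_eq_lintegral_of_nonneg_ae _ (Measurable.aestronglyMeasurable (by fun_prop)),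
    lintegral_rpow_div_add hα ha, ENNReal.toReal_ofReal (by positivity)]
  filter_upwards [ae_restrict_mem measurableSet_Ioi] with x hx
  have hx : 0 < x := hx
  change 0 ≤ x ^ (α - 1) / (x + a)
  positivity

theorem exists_mul_add_norm_le_norm_add {w : ℂ} (hw : w ∈ Complex.slitPlane) :
    ∃ κ > (0 : ℝ), ∀ x : ℝ, κ * (x + ‖w‖) ≤ ‖(x : ℂ) + w‖ := by
  have hρ : 0 < ‖w‖ := norm_pos_iff.2 (Complex.slitPlane_ne_zero hw)
  have hre : 0 < ‖w‖ + w.re := by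
    rcases hw with h | h
    · positivity
    · linarith [(abs_lt.1 (Complex.abs_re_lt_norm.2 h)).1]
  refine ⟨√((‖w‖ + w.re) / (2 * ‖w‖)), by positivity, fun x => ?_⟩
  refine le_of_sq_le_sq ?_ (norm_nonneg _)
  rw [mul_pow, Real.sq_sqrt (by positivity)]
  have h1 : ‖(x : ℂ) + w‖ ^ 2 = x ^ 2 + 2 * x * w.re + ‖w‖ ^ 2 := by
    rw [Complex.sq_norm, Complex.sq_norm, Complex.normSq_apply, Complex.normSq_apply]
    simp
    ring
  have h2 : 0 ≤ (‖w‖ - w.re) / (2 * ‖w‖) * (x - ‖w‖) ^ 2 :=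
    mul_nonneg (div_nonneg (by linarith [Complex.re_le_norm w]) (by positivity)) (sq_nonneg _)
  have h3 : x ^ 2 + 2 * x * w.re + ‖w‖ ^ 2 - (‖w‖ + w.re) / (2 * ‖w‖) * (x + ‖w‖) ^ 2 =
      (‖w‖ - w.re) / (2 * ‖w‖) * (x - ‖w‖) ^ 2 := by
    field_simp
    ring
  rw [h1]
  linarith

/-- The Stieltjes transform of `x ^ (α - 1)` on the positive half-line. -/
noncomputable def rpowStieltjes (α : ℝ) (w : ℂ) : ℂ :=
  ∫ x in Set.Ioi (0 : ℝ), ((x ^ (α - 1) : ℝ) : ℂ) * ((x : ℂ) + w)⁻¹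

theorem differentiableAt_rpowStieltjes {α : ℝ} (hα : α ∈ Set.Ioo (0 : ℝ) 1) {w : ℂ}
    (hw : w ∈ Complex.slitPlane) : DifferentiableAt ℂ (rpowStieltjes α) w := by
  obtain ⟨κ, hκ, hle⟩ := exists_mul_add_norm_le_norm_add hw
  have hρ : 0 < ‖w‖ := norm_pos_iff.2 (Complex.slitPlane_ne_zero hw)
  have hlow : ∀ x ∈ Set.Ioi (0 : ℝ), ∀ v ∈ ball w (κ * ‖w‖ / 2),
      κ / 2 * (x + ‖w‖) ≤ ‖(x : ℂ) + v‖ := by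
    intro x hx v hv
    have hx : 0 < x := hx
    have h1 : ‖(x : ℂ) + w‖ ≤ ‖(x : ℂ) + v‖ + ‖w - v‖ := by
      have h := norm_add_le ((x : ℂ) + v) (w - v)
      rwa [add_add_sub_cancel] at h
    have h2 : ‖w - v‖ < κ * ‖w‖ / 2 := by rwa [← dist_eq_norm, dist_comm]
    nlinarith [hle x, mul_pos hκ hx]
  have hmeas : ∀ v : ℂ, AEStronglyMeasurable
      (fun x : ℝ => ((x ^ (α - 1) : ℝ) : ℂ) * ((x : ℂ) + v)⁻¹) (volume.restrict (Set.Ioi 0)) :=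
    fun v => Measurable.aestronglyMeasurable (by fun_prop)
  have hself : w ∈ ball w (κ * ‖w‖ / 2) := mem_ball_self (by positivity)
  refine (hasDerivAt_integral_of_dominated_loc_of_deriv_le
    (F' := fun v x => ((x ^ (α - 1) : ℝ) : ℂ) * (-1 / ((x : ℂ) + v) ^ 2))
    (bound := fun x => (4 / κ ^ 2 / ‖w‖) * (x ^ (α - 1) / (x + ‖w‖)))
    (ball_mem_nhds w (show 0 < κ * ‖w‖ / 2 by positivity)) (.of_forall hmeas) ?_
    (Measurable.aestronglyMeasurable (by fun_prop)) ?_ ?_ ?_).2.differentiableAt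
  · refine ((integrableOn_rpow_div_add hα hρ).const_mul (2 / κ)).mono' (hmeas w) ?_
    filter_upwards [ae_restrict_mem measurableSet_Ioi] with x hx
    have h := hlow x hx w hself
    have hx : 0 < x := hx
    rw [norm_mul, norm_inv, Complex.norm_real, Real.norm_of_nonneg (by positivity)]
    calc x ^ (α - 1) * ‖(x : ℂ) + w‖⁻¹ ≤ x ^ (α - 1) * (κ / 2 * (x + ‖w‖))⁻¹ := by gcongr
      _ = _ := by field_simp
  · filter_upwards [ae_restrict_mem measurableSet_Ioi] with x hx v hv
    have h := hlow x hx v hv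
    have hx : 0 < x := hx
    rw [norm_mul, norm_div, norm_neg, norm_one, norm_pow, Complex.norm_real,
      Real.norm_of_nonneg (by positivity)]
    calc x ^ (α - 1) * (1 / ‖(x : ℂ) + v‖ ^ 2)
        ≤ x ^ (α - 1) * (1 / ((κ / 2 * (x + ‖w‖)) * (κ / 2 * ‖w‖))) := by
          rw [pow_two]
          gcongr
          exact le_trans (by gcongr; linarith) h
      _ = _ := by field_simp; norm_num
  · exact (integrableOn_rpow_div_add hα hρ).const_mul _
  · filter_upwards [ae_restrict_mem measurableSet_Ioi] with x hx v hv
    have h := hlow x hx v hv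
    have hx : 0 < x := hx
    have hne : (x : ℂ) + v ≠ 0 := norm_pos_iff.1 (lt_of_lt_of_le (by positivity) h)
    exact (((hasDerivAt_id v).const_add (x : ℂ)).inv hne).const_mul _

theorem rpowStieltjes_eq {α : ℝ} (hα : α ∈ Set.Ioo (0 : ℝ) 1) {w : ℂ}
    (hw : w ∈ Complex.slitPlane) :
    rpowStieltjes α w = ((π / Real.sin (π * α) : ℝ) : ℂ) * w ^ ((α - 1 : ℝ) : ℂ) := by
  have hf : AnalyticOnNhd ℂ (rpowStieltjes α) Complex.slitPlane :=
    DifferentiableOn.analyticOnNhd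
      (fun v hv => (differentiableAt_rpowStieltjes hα hv).differentiableWithinAt)
      Complex.isOpen_slitPlane
  have hg : AnalyticOnNhd ℂ
      (fun w : ℂ => ((π / Real.sin (π * α) : ℝ) : ℂ) * w ^ ((α - 1 : ℝ) : ℂ))
      Complex.slitPlane := fun v hv => analyticAt_const.mul (analyticAt_id.cpow analyticAt_const hv)
  have hreal : ∀ a : ℝ, 0 < a → rpowStieltjes α a =
      ((π / Real.sin (π * α) : ℝ) : ℂ) * (a : ℂ) ^ ((α - 1 : ℝ) : ℂ) := by
    intro a ha
    rw [← Complex.ofReal_cpow ha.le, ← Complex.ofReal_mul, ← integral_rpow_div_add hα ha,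
      ← integral_complex_ofReal, rpowStieltjes]
    simp [div_eq_mul_inv]
  have hconn : IsPreconnected Complex.slitPlane :=
    (Complex.starConvex_one_slitPlane.isPathConnected
      Complex.one_mem_slitPlane).isConnected.isPreconnected
  refine hf.eqOn_of_preconnected_of_frequently_eq hg hconn Complex.one_mem_slitPlane ?_ hw
  have ht : Tendsto (fun a : ℝ => (a : ℂ)) (𝓝[≠] 1) (𝓝[≠] 1) := by
    refine tendsto_nhdsWithin_iff.2 ⟨?_, ?_⟩
    · exact (Complex.continuous_ofReal.tendsto' 1 1 (by simp)).mono_left nhdsWithin_le_nhds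
    · filter_upwards [self_mem_nhdsWithin] with a ha
      simpa using ha
  refine ht.frequently (Eventually.frequently ?_)
  filter_upwards [nhdsWithin_le_nhds (lt_mem_nhds one_pos)] with a ha using hreal a ha

theorem norm_rpowStieltjes {α : ℝ} (hα : α ∈ Set.Ioo (0 : ℝ) 1) {w : ℂ}
    (hw : w ∈ Complex.slitPlane) :
    ‖rpowStieltjes α w‖ = π / Real.sin (π * α) * ‖w‖ ^ (α - 1) := by
  have hsin := sin_pi_mul_pos hα
  rw [rpowStieltjes_eq hα hw, norm_mul, Complex.norm_cpow_real, Complex.norm_real,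
    Real.norm_of_nonneg (by positivity)]

theorem circleAverage_inv_const_sub {z : ℂ} {ρ : ℝ} (hρ : 0 < ρ) (hne : ρ ≠ ‖z‖) :
    circleAverage (fun u => (z - u)⁻¹) 0 ρ = if ρ < ‖z‖ then z⁻¹ else 0 := by
  split_ifs with h
  · have hd : DiffContOnCl ℂ (fun u => (z - u)⁻¹) (ball 0 |ρ|) := by
      refine DifferentiableOn.diffContOnCl (DifferentiableOn.inv (by fun_prop) fun u hu => ?_)
      have hu := closure_ball_subset_closedBall hu
      rw [mem_closedBall_zero_iff, abs_of_pos hρ] at hu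
      intro h0
      rw [← sub_eq_zero.1 h0] at hu
      linarith
    simpa using hd.circleAverage
  · have h : ‖z‖ < ρ := lt_of_le_of_ne (not_lt.1 h) hne.symm
    have hρ' : (ρ : ℂ) ≠ 0 := by exact_mod_cast hρ.ne'
    have hnz : ∀ u : ℂ, ‖u‖ ≤ 1 → z * u - ρ ≠ 0 := by
      intro u hu h0
      have h1 : ‖z * u‖ = ρ := by
        rw [sub_eq_zero.1 h0, Complex.norm_real, Real.norm_of_nonneg hρ.le]
      rw [norm_mul] at h1
      nlinarith [norm_nonneg z, norm_nonneg u]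
    have hd : DiffContOnCl ℂ (fun u : ℂ => u / (z * u - ρ)) (ball 0 |1|) := by
      refine DifferentiableOn.diffContOnCl (DifferentiableOn.div (by fun_prop) (by fun_prop) ?_)
      intro u hu
      have hu := closure_ball_subset_closedBall hu
      rw [mem_closedBall_zero_iff, abs_one] at hu
      exact hnz u hu
    rw [circleAverage_eq_circleAverage_zero_one, ← circleAverage_zero_one_congr_inv,
      circleAverage_congr_sphere (f₂ := fun u : ℂ => u / (z * u - ρ)), hd.circleAverage, zero_div]
    intro u hu
    have hu1 : ‖u‖ = 1 := by simpa using hu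
    have hu0 : u ≠ 0 := norm_ne_zero_iff.1 (by rw [hu1]; exact one_ne_zero)
    change (z - (ρ * u⁻¹ + 0))⁻¹ = u / (z * u - ρ)
    have : z - (ρ * u⁻¹ + 0) = (z * u - ρ) / u := by field_simp; ring
    rw [this, inv_div]

theorem integral_Ioo_polarCoord_inv_sub {z : ℂ} {ρ : ℝ} (hρ : 0 < ρ) (hne : ρ ≠ ‖z‖) :
    ∫ θ in Set.Ioo (-π) π, (z - Complex.polarCoord.symm (ρ, θ))⁻¹ =
      if ρ < ‖z‖ then 2 * π * z⁻¹ else 0 := by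
  have hper : Function.Periodic (fun θ => (z - circleMap 0 ρ θ)⁻¹) (2 * π) := fun θ => by
    simp only [periodic_circleMap 0 ρ θ]
  have h_int := hper.intervalIntegral_add_eq (-π) 0
  rw [show -π + 2 * π = π by ring, zero_add] at h_int
  have havg := circleAverage_inv_const_sub hρ hne
  rw [circleAverage_def, ← h_int, intervalIntegral.integral_of_le (by linarith [Real.pi_pos]),
    integral_Ioc_eq_integral_Ioo, inv_smul_eq_iff₀ (by positivity)] at havg
  have hmap : ∀ θ, Complex.polarCoord.symm (ρ, θ) = circleMap 0 ρ θ := fun θ => by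
    simp [circleMap, Complex.exp_mul_I]
  simp_rw [hmap]
  rw [havg, smul_ite, smul_zero, Complex.real_smul]
  push_cast
  rfl

theorem integrable_norm_rpow_smul_inv_sub {α : ℝ} (hα : α ∈ Set.Ioo (0 : ℝ) 1) {z : ℂ}
    (hz : z ≠ 0) : Integrable fun u : ℂ => (‖u‖ ^ (α - 2)) • (z - u)⁻¹ := by
  have hR : 0 < ‖z‖ := norm_pos_iff.2 hz
  have hfar : Integrable fun u : ℂ => 5 * (‖u‖ ^ (α - 2) / (‖u‖ + ‖z‖)) := by
    refine Integrable.const_mul ?_ 5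
    refine (integrable_fun_norm_addHaar (volume : Measure ℂ)
      (f := fun t : ℝ => t ^ (α - 2) / (t + ‖z‖))).2 ?_
    refine (integrableOn_rpow_div_add hα hR).congr_fun (fun t ht => ?_) measurableSet_Ioi
    have ht : 0 < t := ht
    simp only [Complex.finrank_real_complex, smul_eq_mul]
    rw [show α - 1 = (α - 2) + 1 by ring, Real.rpow_add_one ht.ne']
    ring
  have hnear : Integrable fun u : ℂ =>
      (Set.Iio (‖z‖ / 2)).indicator (fun t => (‖z‖ / 2) ^ (α - 2) * t⁻¹) ‖z - u‖ := by
    refine Integrable.comp_sub_left (f := fun w : ℂ =>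
      (Set.Iio (‖z‖ / 2)).indicator (fun t => (‖z‖ / 2) ^ (α - 2) * t⁻¹) ‖w‖) ?_ z
    refine (integrable_fun_norm_addHaar (volume : Measure ℂ)).2 ?_
    have hconst : IntegrableOn (fun _ : ℝ => (‖z‖ / 2) ^ (α - 2)) (Set.Ioo 0 (‖z‖ / 2)) :=
      integrableOn_const (by simp)
    rw [← Set.Ioi_inter_Iio, Set.inter_comm, ← integrableOn_indicator_iff measurableSet_Iio]
      at hconst
    refine hconst.congr_fun (fun t ht => ?_) measurableSet_Ioi
    have ht : 0 < t := ht
    simp only [Complex.finrank_real_complex, smul_eq_mul, Set.indicator_apply]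
    split_ifs
    · field_simp
      simp
    · simp
  refine (hfar.add hnear).mono' (Measurable.aestronglyMeasurable (by fun_prop))
    (.of_forall fun u => ?_)
  rw [norm_smul, norm_inv, Real.norm_of_nonneg (by positivity), Pi.add_apply]
  have htri : ‖z‖ ≤ ‖z - u‖ + ‖u‖ := by simpa using norm_add_le (z - u) u
  by_cases h : ‖z - u‖ < ‖z‖ / 2
  · rw [Set.indicator_of_mem (by exact h)]
    have h1 : ‖u‖ ^ (α - 2) ≤ (‖z‖ / 2) ^ (α - 2) :=
      Real.rpow_le_rpow_of_nonpos (by positivity) (by linarith) (by linarith [hα.2])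
    have h2 : 0 ≤ 5 * (‖u‖ ^ (α - 2) / (‖u‖ + ‖z‖)) := by positivity
    have h3 := mul_le_mul_of_nonneg_right h1 (inv_nonneg.2 (norm_nonneg (z - u)))
    linarith
  · rw [Set.indicator_of_notMem (by exact h), add_zero]
    have htri' : ‖u‖ ≤ ‖z‖ + ‖z - u‖ := by simpa using norm_sub_le z (z - u)
    have h1 : (‖u‖ + ‖z‖) / 5 ≤ ‖z - u‖ := by linarith
    calc ‖u‖ ^ (α - 2) * ‖z - u‖⁻¹ ≤ ‖u‖ ^ (α - 2) * ((‖u‖ + ‖z‖) / 5)⁻¹ := by gcongr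
      _ = _ := by field_simp

theorem integrableOn_polarCoord_target {g : ℂ → ℂ} (hg : Integrable g) (hm : Measurable g) :
    IntegrableOn (fun p : ℝ × ℝ => p.1 • g (Complex.polarCoord.symm p)) polarCoord.target := by
  have hsymm : Measurable fun p : ℝ × ℝ => Complex.polarCoord.symm p := by
    simp only [Complex.polarCoord_symm_apply]
    fun_prop
  refine ⟨(measurable_fst.smul (hm.comp hsymm)).aestronglyMeasurable, ?_⟩
  have h := hg.2
  rw [hasFiniteIntegral_iff_enorm, ← Complex.lintegral_comp_polarCoord_symm] at h
  rw [hasFiniteIntegral_iff_enorm]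
  convert h using 1
  refine setLIntegral_congr_fun polarCoord.open_target.measurableSet fun p hp => ?_
  change ‖p.1 • g _‖ₑ = _
  rw [enorm_smul, Real.enorm_of_nonneg (le_of_lt hp.1), smul_eq_mul]

theorem integral_norm_rpow_smul_inv_sub {α : ℝ} (hα : α ∈ Set.Ioo (0 : ℝ) 1) {z : ℂ}
    (hz : z ≠ 0) :
    ∫ u : ℂ, (‖u‖ ^ (α - 2)) • (z - u)⁻¹ = ((2 * π / α * ‖z‖ ^ α : ℝ) : ℂ) * z⁻¹ := by
  have hR : 0 < ‖z‖ := norm_pos_iff.2 hz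
  have h_int := integrableOn_polarCoord_target (integrable_norm_rpow_smul_inv_sub hα hz)
    (by fun_prop)
  rw [← Complex.integral_comp_polarCoord_symm]
  rw [polarCoord_target, Measure.volume_eq_prod] at h_int ⊢
  rw [setIntegral_prod _ h_int]
  have hinner : ∀ᵐ ρ ∂(volume : Measure ℝ).restrict (Set.Ioi 0),
      ∫ θ in Set.Ioo (-π) π, (ρ, θ).1 • ((‖Complex.polarCoord.symm (ρ, θ)‖ ^ (α - 2)) •
          (z - Complex.polarCoord.symm (ρ, θ))⁻¹) =
        (Set.Iio ‖z‖).indicator (fun t : ℝ => ((t ^ (α - 1) : ℝ) : ℂ) * (2 * π * z⁻¹)) ρ := by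
    filter_upwards [ae_restrict_mem measurableSet_Ioi,
      ae_restrict_of_ae (Measure.ae_ne volume ‖z‖)] with ρ hρ hne
    have hρ : 0 < ρ := hρ
    simp only [Complex.norm_polarCoord_symm, abs_of_pos hρ]
    rw [integral_smul, integral_smul, integral_Ioo_polarCoord_inv_sub hρ hne, smul_smul,
      show ρ * ρ ^ (α - 2) = ρ ^ (α - 1) by
        rw [mul_comm, ← Real.rpow_add_one hρ.ne']; ring_nf,
      Set.indicator_apply, Complex.real_smul, mul_ite, mul_zero]
    rfl
  rw [integral_congr_ae hinner, integral_indicator measurableSet_Iio,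
    Measure.restrict_restrict measurableSet_Iio, Set.inter_comm, Set.Ioi_inter_Iio,
    integral_mul_const, integral_complex_ofReal, ← integral_Ioc_eq_integral_Ioo,
    ← intervalIntegral.integral_of_le hR.le, integral_rpow (Or.inl (by linarith [hα.1])),
    sub_add_cancel, Real.zero_rpow hα.1.ne']
  push_cast
  ring

theorem norm_cauchy_radial {c α : ℝ} (hc : 0 < c) (hα : α ∈ Set.Ioo (0 : ℝ) 1) {z : ℂ}
    (hz : z ≠ 0) :
    ‖∫ u, (z - u)⁻¹ ∂(volume : Measure ℂ).withDensity
        (fun z => ENNReal.ofReal (c * α / (2 * π) * ‖z‖ ^ (α - 2)))‖ = c * ‖z‖ ^ (α - 1) := by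
  have hα0 := hα.1
  have hR : 0 < ‖z‖ := norm_pos_iff.2 hz
  rw [integral_withDensity_eq_integral_toReal_smul (by fun_prop)
    (.of_forall fun _ => ENNReal.ofReal_lt_top)]
  have h : ∀ u : ℂ, (ENNReal.ofReal (c * α / (2 * π) * ‖u‖ ^ (α - 2))).toReal • (z - u)⁻¹ =
      (c * α / (2 * π)) • (‖u‖ ^ (α - 2)) • (z - u)⁻¹ := fun u => by
    rw [ENNReal.toReal_ofReal (by positivity), mul_smul]
  simp_rw [h]
  rw [integral_smul, integral_norm_rpow_smul_inv_sub hα hz, norm_smul, norm_mul, norm_inv,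
    Complex.norm_real, Real.norm_of_nonneg (by positivity), Real.norm_of_nonneg (by positivity),
    Real.rpow_sub_one hR.ne']
  field_simp

theorem norm_cauchy_halfLine {c α : ℝ} (hc : 0 < c) (hα : α ∈ Set.Ioo (0 : ℝ) 1) {z : ℂ}
    (hz : -z ∈ Complex.slitPlane) :
    ‖∫ u, (z - u)⁻¹ ∂Measure.map (fun x : ℝ => (x : ℂ))
        (((volume : Measure ℝ).restrict (Set.Ioi 0)).withDensity
          (fun x => ENNReal.ofReal (c * α * x ^ (α - 1))))‖ =
      c * α * π / Real.sin (π * α) * ‖z‖ ^ (α - 1) := by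
  have hα0 := hα.1
  rw [integral_map (by fun_prop) (Measurable.aestronglyMeasurable (by fun_prop)),
    integral_withDensity_eq_integral_toReal_smul (by fun_prop)
      (.of_forall fun _ => ENNReal.ofReal_lt_top)]
  have h : ∀ x ∈ Set.Ioi (0 : ℝ),
      (ENNReal.ofReal (c * α * x ^ (α - 1))).toReal • (z - (x : ℂ))⁻¹ =
        (-(c * α)) • (((x ^ (α - 1) : ℝ) : ℂ) * ((x : ℂ) + -z)⁻¹) := fun x hx => by
    have hx : 0 < x := hx
    rw [ENNReal.toReal_ofReal (by positivity), ← Complex.real_smul, mul_smul, neg_smul,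
      ← smul_neg, ← smul_neg, ← inv_neg]
    ring_nf
  rw [setIntegral_congr_fun measurableSet_Ioi h, integral_smul, ← rpowStieltjes, norm_smul,
    norm_rpowStieltjes hα hz, norm_neg, norm_neg, Real.norm_of_nonneg (by positivity)]
  ring

theorem ae_neg_mem_slitPlane : ∀ᵐ z : ℂ, -z ∈ Complex.slitPlane := by
  have h : (volume : Measure ℂ) (LinearMap.ker Complex.imLm) = 0 := by
    refine Measure.addHaar_submodule _ _ fun htop => ?_
    have : Complex.I ∈ LinearMap.ker Complex.imLm := htop ▸ Submodule.mem_top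
    simp at this
  filter_upwards [measure_eq_zero_iff_ae_notMem.1 h] with z hz
  right
  simpa using hz

/-- Subsection 3.1: the measures `ω_∞` (radial) and `ω₀` (on the positive half-line)
both satisfy `ω(B(0,r)) = c·r^α`, and their local kinetic energies realize respectively
the lower and the upper bound in the main energy estimate; in particular both bounds
are attained. -/
theorem stmt13 (c α : ℝ) (hc : 0 < c) (hα : α ∈ Set.Ioo (0 : ℝ) 1)
    (ωinf ω0 : Measure ℂ)
    (hinf : ωinf = volume.withDensity
      (fun z => ENNReal.ofReal (c * α / (2 * π) * ‖z‖ ^ (α - 2))))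
    (h0 : ω0 = Measure.map (fun x : ℝ => (x : ℂ))
      (((volume : Measure ℝ).restrict (Set.Ioi 0)).withDensity
        (fun x => ENNReal.ofReal (c * α * x ^ (α - 1))))) :
    ∀ r > (0 : ℝ),
      (ωinf (ball (0 : ℂ) r) = ENNReal.ofReal (c * r ^ α) ∧
        ω0 (ball (0 : ℂ) r) = ENNReal.ofReal (c * r ^ α)) ∧
      localEnergy ωinf r = ENNReal.ofReal (c ^ 2 / (4 * π * α) * r ^ (2 * α)) ∧
      localEnergy ω0 r =
        ENNReal.ofReal (c ^ 2 * α * π / (4 * Real.sin (π * α) ^ 2) * r ^ (2 * α)) := by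
  intro r hr
  have hα0 := hα.1
  have hsin := sin_pi_mul_pos hα
  subst hinf h0
  refine ⟨⟨?_, ?_⟩, ?_, ?_⟩
  · rw [withDensity_apply _ measurableSet_ball,
      lintegral_ball_norm_rpow (by linarith) (by positivity) hr, sub_add_cancel]
    congr 1
    field_simp
  · have hpre : (fun x : ℝ => (x : ℂ)) ⁻¹' ball 0 r ∩ Set.Ioi 0 = Set.Ioo 0 r := by
      ext x
      simp only [Set.mem_inter_iff, Set.mem_preimage, mem_ball_zero_iff, Complex.norm_real,
        Real.norm_eq_abs, Set.mem_Ioi, Set.mem_Ioo]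
      exact ⟨fun h => ⟨h.2, (le_abs_self x).trans_lt h.1⟩,
        fun h => ⟨by rw [abs_of_pos h.1]; exact h.2, h.1⟩⟩
    have hmeas : MeasurableSet ((fun x : ℝ => (x : ℂ)) ⁻¹' ball 0 r) :=
      Complex.measurable_ofReal measurableSet_ball
    rw [Measure.map_apply Complex.measurable_ofReal measurableSet_ball,
      withDensity_apply _ hmeas, Measure.restrict_restrict hmeas, hpre,
      lintegral_Ioo_rpow (by linarith) (by positivity) hr, sub_add_cancel]
    congr 1
    field_simp
  · exact localEnergy_of_norm_cauchy_eq hα0 hr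
      ((Measure.ae_ne volume 0).mono fun z hz => norm_cauchy_radial hc hα hz)
  · rw [localEnergy_of_norm_cauchy_eq hα0 hr
      (ae_neg_mem_slitPlane.mono fun z hz => norm_cauchy_halfLine hc hα hz)]
    congr 1
    field_simp
end

section
/- Fix μ ∈ (1/2,1), set α = 2 − 1/μ, and fix r > 0. For t > 0 let ω_t be the Kaden vorticity (the pushforward under γ_t(s) = s·exp(i·(t/(2π))·s^{−1/μ}) of the measure (2 − 1/μ)·s^{1−1/μ} ds on (0,∞)), and let ω_∞ be the measure with density dω_∞(z) = (α/(2π))·|z|^{α−2} dz. Let u(t) and u_∞ denote the Biot-Savart velocities of ω_t and ω_∞ respectively. Then lim_{t→∞} ∫_{B(0,r)} |u(t)(x) − u_∞(x)|² dx = 0; in particular lim_{t→∞} E_r(ω_t) = E_r(ω_∞). -/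
open MeasureTheory Metric Real Filter
open scoped ENNReal NNReal Topology

/-- The parametrization of the Kaden spiral: `γ_t(s) = s·exp(i·(t/(2π))·s^{-1/μ})`. -/
noncomputable def kadenCurve (μ t s : ℝ) : ℂ :=
  (s : ℂ) * Complex.exp (Complex.I * ((t / (2 * π) * s ^ (-1 / μ) : ℝ) : ℂ))

/-- The Kaden vorticity `ω_t`: the pushforward under `γ_t` of the measure
`(2 - 1/μ)·s^{1-1/μ} ds` on `(0,∞)`. -/
noncomputable def kadenMeasure (μ t : ℝ) : Measure ℂ :=
  Measure.map (kadenCurve μ t)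
    (((volume : Measure ℝ).restrict (Set.Ioi 0)).withDensity
      (fun s => ENNReal.ofReal ((2 - 1 / μ) * s ^ (1 - 1 / μ))))


open Set in
theorem integral_exp_int_mul_I (m : ℤ) :
    ∫ θ in Ioo (-π) π, Complex.exp (m * θ * Complex.I) = if m = 0 then (2 * π : ℂ) else 0 := by
  rw [← integral_Ioc_eq_integral_Ioo,
    ← intervalIntegral.integral_of_le (by linarith [pi_pos])]
  split_ifs with h
  · simp [h]; ring
  · have hc : (m * Complex.I : ℂ) ≠ 0 := by simp [h]
    have e : ∀ θ : ℝ, (m * θ * Complex.I : ℂ) = m * Complex.I * θ := fun θ => by ring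
    simp_rw [e]
    rw [integral_exp_mul_complex hc, div_eq_zero_iff]
    left
    rw [sub_eq_zero, Complex.exp_eq_exp_iff_exists_int]
    exact ⟨m, by push_cast; ring⟩

/-- Finite Parseval identity on the circle. -/
theorem lintegral_enorm_sq_sum_exp (N : ℕ) (c : ℕ → ℂ) (e : ℕ → ℤ) (he : Function.Injective e) :
    ∫⁻ θ in Set.Ioo (-π) π,
        ‖∑ n ∈ Finset.range N, c n * Complex.exp (e n * θ * Complex.I)‖ₑ ^ 2
      = ENNReal.ofReal (2 * π * ∑ n ∈ Finset.range N, ‖c n‖ ^ 2) := by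
  set f : ℝ → ℂ := fun θ => ∑ n ∈ Finset.range N, c n * Complex.exp (e n * θ * Complex.I) with hf
  have hfc : Continuous f := by fun_prop
  have hint : ∀ g : ℝ → ℂ, Continuous g → IntegrableOn g (Set.Ioo (-π) π) := fun g hg =>
    (hg.integrableOn_Icc (a := -π) (b := π)).mono_set Set.Ioo_subset_Icc_self
  have hint' : IntegrableOn (fun θ => ‖f θ‖ ^ 2) (Set.Ioo (-π) π) :=
    ((hfc.norm.pow 2).integrableOn_Icc (a := -π) (b := π)).mono_set Set.Ioo_subset_Icc_self
  have h1 : ∫⁻ θ in Set.Ioo (-π) π, ‖f θ‖ₑ ^ 2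
      = ENNReal.ofReal (∫ θ in Set.Ioo (-π) π, ‖f θ‖ ^ 2) := by
    rw [ofReal_integral_eq_lintegral_ofReal hint' (Eventually.of_forall fun _ => by positivity)]
    refine lintegral_congr fun θ => ?_
    rw [ENNReal.ofReal_pow (norm_nonneg _), ofReal_norm]
  rw [h1]
  congr 1
  apply Complex.ofReal_injective
  rw [← integral_complex_ofReal]
  have h2 : ∀ θ : ℝ, ((‖f θ‖ ^ 2 : ℝ) : ℂ) = ∑ n ∈ Finset.range N, ∑ m ∈ Finset.range N,
      c n * (starRingEnd ℂ) (c m) * Complex.exp (((e n - e m : ℤ) : ℂ) * θ * Complex.I) := by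
    intro θ
    rw [Complex.ofReal_pow, ← Complex.mul_conj', hf]
    simp only [map_sum, map_mul, Finset.sum_mul_sum, ← Complex.exp_conj, Complex.conj_I,
      Complex.conj_ofReal, map_intCast]
    refine Finset.sum_congr rfl fun n _ => Finset.sum_congr rfl fun m _ => ?_
    rw [mul_mul_mul_comm, ← Complex.exp_add]
    congr 2
    push_cast
    ring
  simp_rw [h2]
  rw [integral_finsetSum _ fun n _ => hint _ (by fun_prop)]
  have h3 : ∀ n ∈ Finset.range N, ∫ θ in Set.Ioo (-π) π, ∑ m ∈ Finset.range N,
      c n * (starRingEnd ℂ) (c m) * Complex.exp (((e n - e m : ℤ) : ℂ) * θ * Complex.I)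
      = 2 * π * (‖c n‖ : ℂ) ^ 2 := by
    intro n hn
    rw [integral_finsetSum _ fun n _ => hint _ (by fun_prop)]
    simp_rw [integral_const_mul, integral_exp_int_mul_I, sub_eq_zero, he.eq_iff]
    simp only [mul_ite, mul_zero, Finset.sum_ite_eq, hn, if_true, Complex.mul_conj']
    ring
  rw [Finset.sum_congr rfl h3, ← Finset.mul_sum]
  push_cast
  rfl

/-- Riemann-Lebesgue lemma for the phase `s ^ p`. -/
theorem tendsto_integral_exp_rpow_mul (f : ℝ → ℂ) {p c : ℝ} (hp : p ≠ 0) (hc : c ≠ 0) :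
    Tendsto (fun x : ℝ => ∫ s in Set.Ioi 0,
      Complex.exp (((c * x * s ^ p : ℝ) : ℂ) * Complex.I) * f s) atTop (𝓝 0) := by
  set g : ℝ → ℂ := fun y => ((|p|⁻¹ * (y ^ p⁻¹) ^ (1 - p) : ℝ) : ℂ) * f (y ^ p⁻¹)
  have key : ∀ x : ℝ, ∫ s in Set.Ioi 0,
      Complex.exp (((c * x * s ^ p : ℝ) : ℂ) * Complex.I) * f s
      = ∫ v : ℝ, Real.fourierChar (-(v * (-(c / (2 * π)) * x))) • (Set.Ioi 0).indicator g v := by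
    intro x
    have : ∀ v : ℝ, Real.fourierChar (-(v * (-(c / (2 * π)) * x))) • (Set.Ioi 0).indicator g v
        = (Set.Ioi 0).indicator
          (fun v => Complex.exp (((c * x * v : ℝ) : ℂ) * Complex.I) * g v) v := by
      intro v
      simp only [Set.indicator_apply]
      split_ifs
      · rw [Circle.smul_def, Real.fourierChar_apply, smul_eq_mul]
        congr 4
        field_simp
      · simp
    simp_rw [this]
    rw [integral_indicator measurableSet_Ioi, ← integral_comp_rpow_Ioi
      (fun v => Complex.exp (((c * x * v : ℝ) : ℂ) * Complex.I) * g v) hp]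
    refine setIntegral_congr_fun measurableSet_Ioi fun s hs => ?_
    have hs : 0 < s := hs
    have h1 : (s ^ p) ^ p⁻¹ = s := by rw [← rpow_mul hs.le, mul_inv_cancel₀ hp, rpow_one]
    have h2 : |p| * s ^ (p - 1) * (|p|⁻¹ * s ^ (1 - p)) = 1 := by
      rw [mul_mul_mul_comm, mul_inv_cancel₀ (abs_ne_zero.2 hp), ← rpow_add hs]
      simp
    simp only [g, h1, Complex.real_smul]
    rw [mul_left_comm, ← mul_assoc ((_ : ℝ) : ℂ) ((_ : ℝ) : ℂ), ← Complex.ofReal_mul, h2]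
    simp
  simp_rw [key]
  refine (Real.tendsto_integral_exp_smul_cocompact _).comp ?_
  exact (Homeomorph.mulLeft₀ (-(c / (2 * π))) (by simp [hc, pi_ne_zero])).isClosedEmbedding.tendsto_cocompact.comp
    (tendsto_id.mono_right atTop_le_cocompact)

theorem tendsto_setIntegral_exp_rpow_mul (f : ℝ → ℂ) {S : Set ℝ} (hS : MeasurableSet S)
    (hS0 : S ⊆ Set.Ioi 0) {p c : ℝ} (hp : p ≠ 0) (hc : c ≠ 0) :
    Tendsto (fun x : ℝ => ∫ s in S,
      Complex.exp (((c * x * s ^ p : ℝ) : ℂ) * Complex.I) * f s) atTop (𝓝 0) := by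
  refine (tendsto_integral_exp_rpow_mul (S.indicator f) hp hc).congr fun x => ?_
  have : (fun s : ℝ => Complex.exp (((c * x * s ^ p : ℝ) : ℂ) * Complex.I) * S.indicator f s)
      = S.indicator fun s => Complex.exp (((c * x * s ^ p : ℝ) : ℂ) * Complex.I) * f s := by
    ext s
    by_cases hs : s ∈ S <;> simp [hs]
  rw [this, setIntegral_indicator hS, Set.inter_eq_right.2 hS0]

/-- Integrated geometric series. -/
theorem tendsto_sum_integral_geometric {X : Type*} [MeasurableSpace X] {ν : Measure X}
    {F q : X → ℂ} (hF : Integrable F ν) (hq : Measurable q) (hq1 : ∀ᵐ x ∂ν, ‖q x‖ < 1) :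
    Tendsto (fun N : ℕ => ∑ n ∈ Finset.range N, ∫ x, q x ^ n * (1 - q x) * F x ∂ν) atTop
      (𝓝 (∫ x, F x ∂ν)) := by
  have hint : ∀ n : ℕ, Integrable (fun x => q x ^ n * (1 - q x) * F x) ν := fun n => by
    refine (hF.bdd_mul (c := 2) (by fun_prop) ?_)
    filter_upwards [hq1] with x hx
    rw [norm_mul, norm_pow]
    have h1 : ‖q x‖ ^ n ≤ 1 := pow_le_one₀ (norm_nonneg _) hx.le
    have h2 : ‖1 - q x‖ ≤ 2 := (norm_sub_le _ _).trans (by simp; linarith)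
    nlinarith [norm_nonneg (1 - q x)]
  have hsum : ∀ N : ℕ, ∑ n ∈ Finset.range N, ∫ x, q x ^ n * (1 - q x) * F x ∂ν
      = ∫ x, (1 - q x ^ N) * F x ∂ν := fun N => by
    rw [← integral_finsetSum _ fun n _ => hint n]
    congr 1 with x
    rw [← Finset.sum_mul, ← Finset.sum_mul, geom_sum_mul_neg]
  simp_rw [hsum]
  refine tendsto_integral_of_dominated_convergence (fun x => 2 * ‖F x‖) (fun N => ?_)
    (hF.norm.const_mul 2) (fun N => ?_) ?_
  · exact AEStronglyMeasurable.mul (by fun_prop) hF.1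
  · filter_upwards [hq1] with x hx
    rw [norm_mul]
    gcongr
    refine (norm_sub_le _ _).trans ?_
    have : ‖q x‖ ^ N ≤ 1 := pow_le_one₀ (norm_nonneg _) hx.le
    rw [norm_pow, norm_one]
    linarith
  · filter_upwards [hq1] with x hx
    have := ((tendsto_pow_atTop_nhds_zero_of_norm_lt_one hx).const_sub 1).mul_const (F x)
    simpa using this

theorem measurable_kadenCurve (μ t : ℝ) : Measurable (kadenCurve μ t) := by
  unfold kadenCurve
  fun_prop

theorem norm_kadenCurve (μ t : ℝ) {s : ℝ} (hs : 0 ≤ s) : ‖kadenCurve μ t s‖ = s := by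
  rw [kadenCurve, norm_mul, mul_comm Complex.I, Complex.norm_exp_ofReal_mul_I, mul_one,
    Complex.norm_of_nonneg hs]

theorem kadenCurve_pow (μ t s : ℝ) (n : ℕ) : kadenCurve μ t s ^ n
    = Complex.exp (((n / (2 * π) * t * s ^ (-1 / μ) : ℝ) : ℂ) * Complex.I) * (s : ℂ) ^ n := by
  rw [kadenCurve, mul_pow, ← Complex.exp_nat_mul, mul_comm]
  congr 2
  push_cast
  ring

theorem kadenCurve_inv_pow (μ t s : ℝ) (n : ℕ) : (kadenCurve μ t s)⁻¹ ^ n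
    = Complex.exp (((-n / (2 * π) * t * s ^ (-1 / μ) : ℝ) : ℂ) * Complex.I) * (s : ℂ)⁻¹ ^ n := by
  rw [inv_pow, kadenCurve_pow, mul_inv, ← Complex.exp_neg, inv_pow]
  congr 2
  push_cast
  ring

/-- Scaling relation of the Kaden spirals. -/
theorem kadenCurve_mul (μ t : ℝ) {ρ s : ℝ} (hρ : 0 ≤ ρ) (hs : 0 ≤ s) :
    kadenCurve μ t (ρ * s) = ρ * kadenCurve μ (t * ρ ^ (-1 / μ)) s := by
  rw [kadenCurve, kadenCurve, mul_rpow hρ hs, Complex.ofReal_mul, mul_assoc]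
  congr 5
  ring

/-- The conjugate velocity, up to a factor, of the Kaden spiral. -/
noncomputable def kadenCauchy (μ α t : ℝ) (z : ℂ) : ℂ :=
  ∫ s in Set.Ioi 0, ((α * s ^ (α - 1) : ℝ) : ℂ) * (z - kadenCurve μ t s)⁻¹

/-- Moments of the part of the Kaden spiral inside the unit disc. -/
noncomputable def kadenInner (μ α t : ℝ) (n : ℕ) : ℂ :=
  ∫ s in Set.Ioo 0 1, ((α * s ^ (α - 1) : ℝ) : ℂ) * kadenCurve μ t s ^ n

/-- Moments of the part of the Kaden spiral outside the unit disc. -/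
noncomputable def kadenOuter (μ α t : ℝ) (n : ℕ) : ℂ :=
  ∫ s in Set.Ioi 1, ((α * s ^ (α - 1) : ℝ) : ℂ) * (kadenCurve μ t s)⁻¹ ^ (n + 1)

theorem exists_le_norm_sub_kadenCurve (μ t : ℝ) {z : ℂ} (hz : ‖z‖ = 1)
    (hz1 : z ≠ kadenCurve μ t 1) :
    ∃ c > 0, ∀ s > 0, c * max 1 s ≤ ‖z - kadenCurve μ t s‖ := by
  have hcont : ContinuousOn (fun s => ‖z - kadenCurve μ t s‖) (Set.Icc (1 / 2) 2) := by
    unfold kadenCurve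
    have : ContinuousOn (fun s : ℝ => s ^ (-1 / μ)) (Set.Icc (1 / 2) 2) := fun s hs =>
      (continuousAt_rpow_const s _ (Or.inl (by linarith [hs.1]))).continuousWithinAt
    fun_prop
  obtain ⟨s₀, hs₀, hmin⟩ := isCompact_Icc.exists_isMinOn ⟨1, by norm_num⟩ hcont
  have habs : ∀ s > 0, |1 - s| ≤ ‖z - kadenCurve μ t s‖ := fun s hs => by
    simpa [hz, norm_kadenCurve μ t hs.le] using abs_norm_sub_norm_le z (kadenCurve μ t s)
  have hpos : 0 < ‖z - kadenCurve μ t s₀‖ := by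
    have h0 : 0 < s₀ := by linarith [hs₀.1]
    by_cases h : s₀ = 1
    · rw [h]; exact norm_pos_iff.2 (sub_ne_zero.2 hz1)
    · exact (abs_pos.2 (sub_ne_zero.2 (Ne.symm h))).trans_le (habs _ h0)
  set m := ‖z - kadenCurve μ t s₀‖
  refine ⟨min (m / 2) (1 / 2), by positivity, fun s hs => ?_⟩
  have hm1 := min_le_left (m / 2) (1 / 2)
  have hm2 := min_le_right (m / 2) (1 / 2)
  have hm3 : 0 < min (m / 2) (1 / 2) := by positivity
  have h1 := habs s hs
  rcases le_total s 2 with h2 | h2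
  · rcases le_total s (1 / 2) with h3 | h3
    · rw [max_eq_left (by linarith)]
      linarith [le_abs_self (1 - s)]
    · have h4 : m ≤ ‖z - kadenCurve μ t s‖ := hmin (a := s) ⟨h3, h2⟩
      have h5 : max 1 s ≤ 2 := max_le (by norm_num) h2
      nlinarith
  · rw [max_eq_right (by linarith)]
    have := neg_abs_le (1 - s)
    nlinarith

theorem integrableOn_inv_sub_kadenCurve (μ t : ℝ) {α : ℝ} (hα0 : 0 < α) (hα1 : α < 1) {z : ℂ}
    (hz : ‖z‖ = 1) (hz1 : z ≠ kadenCurve μ t 1) :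
    IntegrableOn (fun s : ℝ => ((α * s ^ (α - 1) : ℝ) : ℂ) * (z - kadenCurve μ t s)⁻¹)
      (Set.Ioi 0) := by
  obtain ⟨c, hc, hb⟩ := exists_le_norm_sub_kadenCurve μ t hz hz1
  have hmeas := measurable_kadenCurve μ t
  have hm : Measurable
      (fun s : ℝ => ((α * s ^ (α - 1) : ℝ) : ℂ) * (z - kadenCurve μ t s)⁻¹) := by fun_prop
  have hbound : ∀ s > 0, ‖((α * s ^ (α - 1) : ℝ) : ℂ) * (z - kadenCurve μ t s)⁻¹‖
      ≤ c⁻¹ * α * (s ^ (α - 1) * (max 1 s)⁻¹) := fun s hs => by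
    have hmax : 0 < max 1 s := by positivity
    rw [norm_mul, norm_inv, Complex.norm_of_nonneg (by positivity)]
    calc α * s ^ (α - 1) * ‖z - kadenCurve μ t s‖⁻¹
        ≤ α * s ^ (α - 1) * (c * max 1 s)⁻¹ := by
          gcongr
          exact hb s hs
      _ = _ := by rw [mul_inv]; ring
  rw [← Set.Ioc_union_Ioi_eq_Ioi (zero_le_one' ℝ)]
  refine IntegrableOn.union ?_ ?_
  · have h : IntegrableOn (fun s : ℝ => c⁻¹ * α * s ^ (α - 1)) (Set.Ioo 0 1) :=
      ((intervalIntegral.integrableOn_Ioo_rpow_iff one_pos).2 (by linarith)).const_mul _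
    rw [← integrableOn_Ioc_iff_integrableOn_Ioo] at h
    refine Integrable.mono' h hm.aestronglyMeasurable ?_
    filter_upwards [ae_restrict_mem measurableSet_Ioc] with s hs
    simpa [max_eq_left hs.2] using hbound s hs.1
  · have h := ((integrableOn_Ioi_rpow_of_lt (show α - 2 < -1 by linarith) one_pos)).const_mul
      (c⁻¹ * α)
    refine Integrable.mono' h hm.aestronglyMeasurable ?_
    filter_upwards [ae_restrict_mem measurableSet_Ioi] with s hs
    have hs : 1 < s := hs
    have h0 : 0 < s := by linarith
    have := hbound s h0
    rwa [max_eq_right hs.le, ← rpow_neg_one s, ← rpow_add h0,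
      show α - 1 + -1 = α - 2 by ring] at this

theorem kadenInner_zero (μ t : ℝ) {α : ℝ} (hα0 : 0 < α) : kadenInner μ α t 0 = 1 := by
  simp only [kadenInner, pow_zero, mul_one]
  rw [integral_complex_ofReal, integral_const_mul, ← integral_Ioc_eq_integral_Ioo,
    ← intervalIntegral.integral_of_le zero_le_one, integral_rpow (Or.inl (by linarith))]
  simp [ne_of_gt hα0]

/-- Laurent expansion of the velocity on the unit circle. -/
theorem tendsto_kadenCauchy (μ t : ℝ) {α : ℝ} (hα0 : 0 < α) (hα1 : α < 1) {z : ℂ}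
    (hz : ‖z‖ = 1) (hz1 : z ≠ kadenCurve μ t 1) :
    Tendsto (fun N : ℕ => ∑ n ∈ Finset.range N, kadenInner μ α t (n + 1) * z⁻¹ ^ (n + 2)
      - ∑ n ∈ Finset.range N, kadenOuter μ α t n * z ^ n) atTop
      (𝓝 (kadenCauchy μ α t z - z⁻¹)) := by
  have hint := integrableOn_inv_sub_kadenCurve μ t hα0 hα1 hz hz1
  have hmeas := measurable_kadenCurve μ t
  have hz0 : z ≠ 0 := by rintro rfl; simp at hz
  have hne : ∀ s > 0, s ≠ 1 → z - kadenCurve μ t s ≠ 0 := fun s hs h1 h => h1 <| by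
    rw [← norm_kadenCurve μ t hs.le, ← sub_eq_zero.1 h, hz]
  have hinner : Tendsto (fun N : ℕ => ∑ n ∈ Finset.range N, kadenInner μ α t n * z⁻¹ ^ (n + 1))
      atTop (𝓝 (∫ s in Set.Ioo 0 1,
        ((α * s ^ (α - 1) : ℝ) : ℂ) * (z - kadenCurve μ t s)⁻¹)) := by
    have h := tendsto_sum_integral_geometric (q := fun s => kadenCurve μ t s / z)
      (hint.mono_set Set.Ioo_subset_Ioi_self) (by fun_prop) (by
        filter_upwards [ae_restrict_mem measurableSet_Ioo] with s hs
        rw [norm_div, hz, div_one, norm_kadenCurve μ t hs.1.le]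
        exact hs.2)
    refine h.congr fun N => Finset.sum_congr rfl fun n _ => ?_
    rw [kadenInner, ← integral_mul_const]
    refine setIntegral_congr_fun measurableSet_Ioo fun s hs => ?_
    have := hne s hs.1 hs.2.ne
    simp only [div_pow, inv_pow]
    field_simp
    ring
  have houter : Tendsto (fun N : ℕ => - ∑ n ∈ Finset.range N, kadenOuter μ α t n * z ^ n)
      atTop (𝓝 (∫ s in Set.Ioi 1,
        ((α * s ^ (α - 1) : ℝ) : ℂ) * (z - kadenCurve μ t s)⁻¹)) := by
    have h := tendsto_sum_integral_geometric (q := fun s => z / kadenCurve μ t s)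
      (hint.mono_set (Set.Ioi_subset_Ioi zero_le_one)) (by fun_prop) (by
        filter_upwards [ae_restrict_mem measurableSet_Ioi] with s hs
        have hs : 1 < s := hs
        rw [norm_div, hz, norm_kadenCurve μ t (by linarith)]
        exact (div_lt_one (by linarith)).2 hs)
    refine h.congr fun N => ?_
    rw [← Finset.sum_neg_distrib]
    refine Finset.sum_congr rfl fun n _ => ?_
    rw [kadenOuter, ← integral_mul_const, ← integral_neg]
    refine setIntegral_congr_fun measurableSet_Ioi fun s hs => ?_
    have hs : 1 < s := hs
    have h1 := hne s (by linarith) hs.ne'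
    have h2 : kadenCurve μ t s ≠ 0 := by
      rw [← norm_pos_iff, norm_kadenCurve μ t (by linarith)]
      linarith
    simp only [div_pow, inv_pow]
    field_simp
    ring
  have hsplit : kadenCauchy μ α t z = (∫ s in Set.Ioo 0 1,
      ((α * s ^ (α - 1) : ℝ) : ℂ) * (z - kadenCurve μ t s)⁻¹) + ∫ s in Set.Ioi 1,
      ((α * s ^ (α - 1) : ℝ) : ℂ) * (z - kadenCurve μ t s)⁻¹ := by
    rw [kadenCauchy, ← Set.Ioc_union_Ioi_eq_Ioi (zero_le_one' ℝ),
      setIntegral_union Set.Ioc_disjoint_Ioi_same measurableSet_Ioi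
        (hint.mono_set Set.Ioc_subset_Ioi_self) (hint.mono_set (Set.Ioi_subset_Ioi zero_le_one)),
      integral_Ioc_eq_integral_Ioo]
  have h := (((tendsto_add_atTop_iff_nat 1).2 hinner).sub_const z⁻¹).add houter
  rw [← add_sub_right_comm, ← hsplit] at h
  refine h.congr fun N => ?_
  rw [Finset.sum_range_succ', kadenInner_zero μ t hα0]
  ring

theorem norm_kadenInner_le (μ t : ℝ) {α : ℝ} (hα0 : 0 < α) (n : ℕ) :
    ‖kadenInner μ α t n‖ ≤ α / (n + α) := by
  have hint : IntegrableOn (fun s : ℝ => α * s ^ (α - 1 + n)) (Set.Ioo 0 1) :=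
    ((intervalIntegral.integrableOn_Ioo_rpow_iff one_pos).2
      (by have : (0 : ℝ) ≤ n := n.cast_nonneg
          linarith)).const_mul _
  have hval : ∫ s in Set.Ioo (0 : ℝ) 1, α * s ^ (α - 1 + n) = α / (n + α) := by
    have h0 : 0 < n + α := by positivity
    rw [integral_const_mul, ← integral_Ioc_eq_integral_Ioo,
      ← intervalIntegral.integral_of_le zero_le_one, integral_rpow (Or.inl (by linarith)),
      show α - 1 + n + 1 = n + α by ring, one_rpow, zero_rpow h0.ne', sub_zero, mul_one_div]
  rw [← hval]
  refine norm_integral_le_of_norm_le hint ?_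
  filter_upwards [ae_restrict_mem measurableSet_Ioo] with s hs
  have hs0 : 0 < s := hs.1
  rw [norm_mul, norm_pow, norm_kadenCurve μ t hs0.le, Complex.norm_of_nonneg (by positivity),
    rpow_add_natCast hs0.ne', mul_assoc]

theorem norm_kadenOuter_le (μ t : ℝ) {α : ℝ} (hα0 : 0 < α) (hα1 : α < 1) (n : ℕ) :
    ‖kadenOuter μ α t n‖ ≤ α / (n + 1 - α) := by
  have hn : (0 : ℝ) ≤ n := n.cast_nonneg
  have hexp : α - 1 - ((n + 1 : ℕ) : ℝ) < -1 := by push_cast; linarith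
  have hint : IntegrableOn (fun s : ℝ => α * s ^ (α - 1 - ((n + 1 : ℕ) : ℝ))) (Set.Ioi 1) :=
    (integrableOn_Ioi_rpow_of_lt hexp one_pos).const_mul _
  have hval : ∫ s in Set.Ioi (1 : ℝ), α * s ^ (α - 1 - ((n + 1 : ℕ) : ℝ)) = α / (n + 1 - α) := by
    rw [integral_const_mul, integral_Ioi_rpow_of_lt hexp one_pos, one_rpow, neg_div,
      ← div_neg, mul_one_div]
    congr 1
    push_cast
    ring
  rw [← hval]
  refine norm_integral_le_of_norm_le hint ?_
  filter_upwards [ae_restrict_mem measurableSet_Ioi] with s hs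
  have hs0 : 0 < s := zero_lt_one.trans hs
  rw [norm_mul, norm_pow, norm_inv, norm_kadenCurve μ t hs0.le,
    Complex.norm_of_nonneg (by positivity), rpow_sub_natCast hs0.ne', mul_assoc, inv_pow,
    div_eq_mul_inv]

theorem tendsto_kadenInner {μ : ℝ} (hμ : 0 < μ) (α : ℝ) (n : ℕ) :
    Tendsto (fun t => kadenInner μ α t (n + 1)) atTop (𝓝 0) := by
  have h := tendsto_setIntegral_exp_rpow_mul
    (fun s => ((α * s ^ (α - 1) : ℝ) : ℂ) * (s : ℂ) ^ (n + 1)) (S := Set.Ioo 0 1)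
    measurableSet_Ioo Set.Ioo_subset_Ioi_self
    (p := -1 / μ) (c := ((n + 1 : ℕ) : ℝ) / (2 * π)) (by simp [hμ.ne']) (by positivity)
  refine h.congr fun t => ?_
  rw [kadenInner]
  refine setIntegral_congr_fun measurableSet_Ioo fun s hs => ?_
  rw [kadenCurve_pow]
  ring

theorem tendsto_kadenOuter {μ : ℝ} (hμ : 0 < μ) (α : ℝ) (n : ℕ) :
    Tendsto (fun t => kadenOuter μ α t n) atTop (𝓝 0) := by
  have h := tendsto_setIntegral_exp_rpow_mul
    (fun s => ((α * s ^ (α - 1) : ℝ) : ℂ) * (s : ℂ)⁻¹ ^ (n + 1)) measurableSet_Ioi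
    (Set.Ioi_subset_Ioi (zero_le_one' ℝ))
    (p := -1 / μ) (c := -((n + 1 : ℕ) : ℝ) / (2 * π)) (by simp [hμ.ne'])
    (div_ne_zero (neg_ne_zero.2 (by positivity)) (by positivity))
  refine h.congr fun t => ?_
  rw [kadenOuter]
  refine setIntegral_congr_fun measurableSet_Ioi fun s hs => ?_
  rw [kadenCurve_inv_pow]
  ring

/-- Sum of squares of the Laurent coefficients on the unit circle. -/
noncomputable def kadenDefect (μ α t : ℝ) : ℝ :=
  ∑' n : ℕ, (‖kadenInner μ α t (n + 1)‖ ^ 2 + ‖kadenOuter μ α t n‖ ^ 2)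

theorem sq_kadenInner_add_sq_kadenOuter_le (μ t : ℝ) {α : ℝ} (hα0 : 0 < α) (hα1 : α < 1) (n : ℕ) :
    ‖kadenInner μ α t (n + 1)‖ ^ 2 + ‖kadenOuter μ α t n‖ ^ 2
      ≤ 2 * (1 / (1 - α)) ^ 2 * (1 / ((n + 1 : ℕ) : ℝ) ^ 2) := by
  have hn : (0 : ℝ) ≤ n := n.cast_nonneg
  have h0 : 0 < 1 - α := by linarith
  have hi : ‖kadenInner μ α t (n + 1)‖ ≤ 1 / (1 - α) * (1 / ((n + 1 : ℕ) : ℝ)) := by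
    refine (norm_kadenInner_le μ t hα0 (n + 1)).trans ?_
    rw [one_div_mul_one_div]
    push_cast
    gcongr
    nlinarith
  have ho : ‖kadenOuter μ α t n‖ ≤ 1 / (1 - α) * (1 / ((n + 1 : ℕ) : ℝ)) := by
    refine (norm_kadenOuter_le μ t hα0 hα1 n).trans ?_
    rw [one_div_mul_one_div]
    push_cast
    gcongr
    nlinarith
  have hi2 := pow_le_pow_left₀ (norm_nonneg _) hi 2
  have ho2 := pow_le_pow_left₀ (norm_nonneg _) ho 2
  rw [mul_pow, one_div_pow ((n + 1 : ℕ) : ℝ)] at hi2 ho2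
  linarith

theorem summable_one_div_succ_sq (C : ℝ) :
    Summable fun n : ℕ => C * (1 / ((n + 1 : ℕ) : ℝ) ^ 2) :=
  ((summable_nat_add_iff 1).2 (Real.summable_one_div_nat_pow.2 one_lt_two)).mul_left C

theorem tendsto_kadenDefect {μ α : ℝ} (hμ : 0 < μ) (hα0 : 0 < α) (hα1 : α < 1) :
    Tendsto (kadenDefect μ α) atTop (𝓝 0) := by
  rw [← tsum_zero (α := ℝ) (β := ℕ)]
  refine tendsto_tsum_of_dominated_convergence
    (summable_one_div_succ_sq (2 * (1 / (1 - α)) ^ 2)) (fun n => ?_)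
    (Eventually.of_forall fun t n => ?_)
  · simpa using ((tendsto_kadenInner hμ α n).norm.pow 2).add
      ((tendsto_kadenOuter hμ α n).norm.pow 2)
  · rw [Real.norm_of_nonneg (by positivity)]
    exact sq_kadenInner_add_sq_kadenOuter_le μ t hα0 hα1 n

theorem enorm_sub_sq_le (a b : ℂ) : ‖a - b‖ₑ ^ 2 ≤ 2 * ‖a‖ₑ ^ 2 + 2 * ‖b‖ₑ ^ 2 := by
  have h : ‖a - b‖ ^ 2 ≤ 2 * ‖a‖ ^ 2 + 2 * ‖b‖ ^ 2 := by
    have := norm_sub_le a b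
    nlinarith [sq_nonneg (‖a‖ - ‖b‖), norm_nonneg (a - b)]
  have := ENNReal.ofReal_le_ofReal h
  rwa [ENNReal.ofReal_add (by positivity) (by positivity), ENNReal.ofReal_mul zero_le_two,
    ENNReal.ofReal_mul zero_le_two, ENNReal.ofReal_pow (norm_nonneg _),
    ENNReal.ofReal_pow (norm_nonneg _), ENNReal.ofReal_pow (norm_nonneg _), ofReal_norm,
    ofReal_norm, ofReal_norm, ENNReal.ofReal_ofNat] at this

theorem ae_exp_mul_I_ne (c : ℂ) :
    ∀ᵐ θ : ℝ ∂(volume.restrict (Set.Ioo (-π) π)), Complex.exp (θ * Complex.I) ≠ c := by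
  rw [ae_restrict_iff' measurableSet_Ioo, ae_iff]
  refine Set.Subsingleton.measure_zero (fun a ha b hb => ?_) _
  simp only [Set.mem_ofPred_eq, Classical.not_imp, not_not] at ha hb
  have h := congrArg Complex.arg (ha.2.trans hb.2.symm)
  rwa [Complex.arg_exp_mul_I, Complex.arg_exp_mul_I,
    (toIocMod_eq_self _).2 (by constructor <;> linarith [ha.1.1, ha.1.2]),
    (toIocMod_eq_self _).2 (by constructor <;> linarith [hb.1.1, hb.1.2])] at h

theorem lintegral_circle_le (μ t : ℝ) {α : ℝ} (hα0 : 0 < α) (hα1 : α < 1) :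
    ∫⁻ θ in Set.Ioo (-π) π, ‖kadenCauchy μ α t (Complex.exp (θ * Complex.I))
        - (Complex.exp (θ * Complex.I))⁻¹‖ₑ ^ 2
      ≤ ENNReal.ofReal (4 * π * kadenDefect μ α t) := by
  set A : ℕ → ℝ → ℂ := fun N θ => ∑ n ∈ Finset.range N,
    kadenInner μ α t (n + 1) * (Complex.exp (θ * Complex.I))⁻¹ ^ (n + 2)
  set B : ℕ → ℝ → ℂ := fun N θ => ∑ n ∈ Finset.range N,
    kadenOuter μ α t n * (Complex.exp (θ * Complex.I)) ^ n
  have hAm : ∀ N, Measurable (A N) := fun N => by fun_prop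
  have hBm : ∀ N, Measurable (B N) := fun N => by fun_prop
  have hA : ∀ N, ∫⁻ θ in Set.Ioo (-π) π, ‖A N θ‖ₑ ^ 2
      = ENNReal.ofReal (2 * π * ∑ n ∈ Finset.range N, ‖kadenInner μ α t (n + 1)‖ ^ 2) := by
    intro N
    rw [← lintegral_enorm_sq_sum_exp N (fun n => kadenInner μ α t (n + 1))
      (fun n => -(n + 2 : ℤ)) (fun a b h => by simpa using h)]
    refine lintegral_congr fun θ => ?_
    have : A N θ = ∑ n ∈ Finset.range N, kadenInner μ α t (n + 1) *
        Complex.exp (((-(n + 2 : ℤ) : ℤ) : ℂ) * θ * Complex.I) := Finset.sum_congr rfl fun n _ => by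
      rw [← Complex.exp_neg, ← Complex.exp_nat_mul]
      congr 2
      push_cast
      ring
    rw [this]
  have hB : ∀ N, ∫⁻ θ in Set.Ioo (-π) π, ‖B N θ‖ₑ ^ 2
      = ENNReal.ofReal (2 * π * ∑ n ∈ Finset.range N, ‖kadenOuter μ α t n‖ ^ 2) := by
    intro N
    rw [← lintegral_enorm_sq_sum_exp N (fun n => kadenOuter μ α t n)
      (fun n => (n : ℤ)) Nat.cast_injective]
    refine lintegral_congr fun θ => ?_
    have : B N θ = ∑ n ∈ Finset.range N, kadenOuter μ α t n *
        Complex.exp (((n : ℤ) : ℂ) * θ * Complex.I) := Finset.sum_congr rfl fun n _ => by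
      rw [← Complex.exp_nat_mul]
      congr 2
      push_cast
      ring
    rw [this]
  have hAB : ∀ N, ∫⁻ θ in Set.Ioo (-π) π, ‖A N θ - B N θ‖ₑ ^ 2
      ≤ ENNReal.ofReal (4 * π * kadenDefect μ α t) := fun N => by
    calc ∫⁻ θ in Set.Ioo (-π) π, ‖A N θ - B N θ‖ₑ ^ 2
        ≤ ∫⁻ θ in Set.Ioo (-π) π, (2 * ‖A N θ‖ₑ ^ 2 + 2 * ‖B N θ‖ₑ ^ 2) :=
          lintegral_mono fun θ => enorm_sub_sq_le _ _
      _ = ENNReal.ofReal (4 * π * ∑ n ∈ Finset.range N,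
            (‖kadenInner μ α t (n + 1)‖ ^ 2 + ‖kadenOuter μ α t n‖ ^ 2)) := by
          rw [lintegral_add_left (by fun_prop), lintegral_const_mul _ (by fun_prop),
            lintegral_const_mul _ (by fun_prop), hA, hB, ← ENNReal.ofReal_ofNat 2,
            ← ENNReal.ofReal_mul zero_le_two, ← ENNReal.ofReal_mul zero_le_two,
            ← ENNReal.ofReal_add (by positivity) (by positivity), Finset.sum_add_distrib]
          congr 1
          ring
      _ ≤ _ := by
          gcongr
          refine Summable.sum_le_tsum _ (fun n _ => by positivity) ?_
          exact Summable.of_nonneg_of_le (fun n => by positivity)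
            (sq_kadenInner_add_sq_kadenOuter_le μ t hα0 hα1) (summable_one_div_succ_sq _)
  calc _ = ∫⁻ θ in Set.Ioo (-π) π, liminf (fun N => ‖A N θ - B N θ‖ₑ ^ 2) atTop := by
        refine lintegral_congr_ae ?_
        filter_upwards [ae_exp_mul_I_ne (kadenCurve μ t 1)] with θ hθ
        have h := tendsto_kadenCauchy μ t hα0 hα1 (Complex.norm_exp_ofReal_mul_I θ) hθ
        exact (((ENNReal.continuous_pow 2).tendsto _).comp
          ((continuous_enorm.tendsto _).comp h)).liminf_eq.symm
    _ ≤ liminf (fun N => ∫⁻ θ in Set.Ioo (-π) π, ‖A N θ - B N θ‖ₑ ^ 2) atTop :=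
        lintegral_liminf_le fun N => by fun_prop
    _ ≤ liminf (fun _ : ℕ => ENNReal.ofReal (4 * π * kadenDefect μ α t)) atTop :=
        liminf_le_liminf (Eventually.of_forall hAB)
    _ = _ := by simp

theorem biotSavart_eq_conj (ω : Measure ℂ) (z : ℂ) :
    biotSavart ω z
      = (2 * π)⁻¹ • (Complex.I * (starRingEnd ℂ) (∫ u, (z - u)⁻¹ ∂ω)) := by
  rw [biotSavart, ← integral_conj, ← integral_const_mul]
  congr 2 with u
  rw [Complex.inv_def, map_mul, Complex.conj_conj, Complex.conj_ofReal, Complex.normSq_eq_norm_sq,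
    mul_div_assoc, div_eq_mul_inv]
  push_cast
  rfl

theorem enorm_biotSavart_sub_le (ω ω' : Measure ℂ) (z : ℂ) :
    ‖biotSavart ω z - biotSavart ω' z‖ₑ
      ≤ ‖(∫ u, (z - u)⁻¹ ∂ω) - ∫ u, (z - u)⁻¹ ∂ω'‖ₑ := by
  rw [biotSavart_eq_conj, biotSavart_eq_conj, ← smul_sub, ← mul_sub, ← map_sub, enorm_smul,
    enorm_mul, ← ofReal_norm Complex.I, Complex.norm_I, ENNReal.ofReal_one, one_mul,
    ← ofReal_norm ((starRingEnd ℂ) _), RCLike.norm_conj, ofReal_norm]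
  refine mul_le_of_le_one_left zero_le ?_
  rw [← ofReal_norm, ENNReal.ofReal_le_one, Real.norm_of_nonneg (by positivity)]
  exact inv_le_one_of_one_le₀ (by linarith [pi_gt_three])

theorem stronglyMeasurable_biotSavart (ω : Measure ℂ) [SFinite ω] :
    StronglyMeasurable (biotSavart ω) := by
  have h : StronglyMeasurable fun z : ℂ =>
      ∫ u, Complex.I * (z - u) / (((‖z - u‖ : ℝ) : ℂ) ^ 2) ∂ω :=
    StronglyMeasurable.integral_prod_right'
      (f := fun p : ℂ × ℂ => Complex.I * (p.1 - p.2) / (((‖p.1 - p.2‖ : ℝ) : ℂ) ^ 2))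
      (Measurable.stronglyMeasurable (by fun_prop))
  exact h.const_smul ((2 * π)⁻¹ : ℝ)

instance (μ t : ℝ) : SFinite (kadenMeasure μ t) := by
  unfold kadenMeasure
  infer_instance

theorem integral_inv_sub_kadenMeasure {μ α : ℝ} (hα : α = 2 - 1 / μ) (hα0 : 0 < α) (t : ℝ)
    (z : ℂ) : ∫ u, (z - u)⁻¹ ∂(kadenMeasure μ t) = kadenCauchy μ α t z := by
  rw [kadenMeasure, integral_map (measurable_kadenCurve μ t).aemeasurable
    (by fun_prop : Measurable fun u : ℂ => (z - u)⁻¹).aestronglyMeasurable,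
    integral_withDensity_eq_integral_toReal_smul (by fun_prop)
      (Eventually.of_forall fun _ => ENNReal.ofReal_lt_top), kadenCauchy]
  refine setIntegral_congr_fun measurableSet_Ioi fun s hs => ?_
  have hs : 0 < s := hs
  rw [← hα, show 1 - 1 / μ = α - 1 by rw [hα]; ring, ENNReal.toReal_ofReal (by positivity),
    Complex.real_smul]

/-- Scaling relation of the Kaden velocities. -/
theorem kadenCauchy_mul (μ α t : ℝ) {ρ : ℝ} (hρ : 0 < ρ) (z : ℂ) :
    kadenCauchy μ α t (ρ * z)
      = ((ρ ^ (α - 1) : ℝ) : ℂ) * kadenCauchy μ α (t * ρ ^ (-1 / μ)) z := by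
  have h := integral_comp_mul_left_Ioi
    (fun s => ((α * s ^ (α - 1) : ℝ) : ℂ) * (ρ * z - kadenCurve μ t s)⁻¹) 0 hρ
  rw [mul_zero, eq_inv_smul_iff₀ hρ.ne'] at h
  rw [kadenCauchy, ← h, kadenCauchy, Complex.real_smul, ← integral_const_mul,
    ← integral_const_mul]
  refine setIntegral_congr_fun measurableSet_Ioi fun s hs => ?_
  have hs : 0 < s := hs
  have hρ' : (ρ : ℂ) ≠ 0 := by exact_mod_cast hρ.ne'
  rw [kadenCurve_mul μ t hρ.le hs.le, ← mul_sub, mul_inv, mul_rpow hρ.le hs.le]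
  push_cast
  field_simp

theorem integrable_indicator_Iio_rpow_norm {a : ℝ} (ha : -2 < a) {R : ℝ} (hR : 0 < R) :
    Integrable fun u : ℂ => (Set.Iio R).indicator (fun y => y ^ a) ‖u‖ := by
  rw [integrable_fun_norm_addHaar, Complex.finrank_real_complex]
  have h : IntegrableOn ((Set.Iio R).indicator fun y : ℝ => y ^ (a + 1)) (Set.Ioi 0) := by
    rw [IntegrableOn, integrable_indicator_iff measurableSet_Iio, IntegrableOn,
      Measure.restrict_restrict measurableSet_Iio, Set.inter_comm, Set.Ioi_inter_Iio]
    exact (intervalIntegral.integrableOn_Ioo_rpow_iff hR).2 (by linarith)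
  refine h.congr_fun (fun y hy => ?_) measurableSet_Ioi
  have hy : 0 < y := hy
  by_cases h : y < R
  · simp [h, rpow_add_one hy.ne', mul_comm]
  · simp [h]

theorem integrable_indicator_Ici_rpow_norm {a : ℝ} (ha : a < -2) {R : ℝ} (hR : 0 < R) :
    Integrable fun u : ℂ => (Set.Ici R).indicator (fun y => y ^ a) ‖u‖ := by
  rw [integrable_fun_norm_addHaar, Complex.finrank_real_complex]
  have h : IntegrableOn ((Set.Ici R).indicator fun y : ℝ => y ^ (a + 1)) (Set.Ioi 0) := by
    rw [IntegrableOn, integrable_indicator_iff measurableSet_Ici, IntegrableOn,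
      Measure.restrict_restrict measurableSet_Ici,
      Set.inter_eq_left.2 (Set.Ici_subset_Ioi.2 hR), ← IntegrableOn,
      integrableOn_Ici_iff_integrableOn_Ioi]
    exact integrableOn_Ioi_rpow_of_lt (by linarith) hR
  refine h.congr_fun (fun y hy => ?_) measurableSet_Ioi
  have hy : 0 < y := hy
  by_cases h : R ≤ y
  · simp [h, rpow_add_one hy.ne', mul_comm]
  · simp [h]

theorem integrable_rpow_norm_mul_inv_sub {α : ℝ} (hα0 : 0 < α) (hα1 : α < 1) {z : ℂ}
    (hz : z ≠ 0) (C : ℝ) :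
    Integrable fun u : ℂ => ((C * ‖u‖ ^ (α - 2) : ℝ) : ℂ) * (z - u)⁻¹ := by
  set R := ‖z‖ / 2 with hR
  have hR0 : 0 < R := by positivity
  have h1 := ((integrable_indicator_Iio_rpow_norm (a := -1) (by norm_num) hR0).comp_sub_left
    z).const_mul (R ^ (α - 2))
  have h2 := (integrable_indicator_Iio_rpow_norm (a := α - 2) (by linarith) hR0).const_mul R⁻¹
  have h3 := (integrable_indicator_Ici_rpow_norm (a := α - 2 - 1) (by linarith) hR0).const_mul 3
  refine (((h1.add h2).add h3).const_mul |C|).mono'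
    (by fun_prop : Measurable fun u : ℂ =>
      ((C * ‖u‖ ^ (α - 2) : ℝ) : ℂ) * (z - u)⁻¹).aestronglyMeasurable
    (Eventually.of_forall fun u => ?_)
  have hnn : ∀ (S : Set ℝ) (a y : ℝ), 0 ≤ y → 0 ≤ S.indicator (fun y => y ^ a) y :=
    fun S a y hy => Set.indicator_apply_nonneg fun _ => by positivity
  have i1 := mul_nonneg (rpow_nonneg hR0.le (α - 2)) (hnn (Set.Iio R) (-1) _ (norm_nonneg (z - u)))
  have i2 := mul_nonneg (inv_nonneg.2 hR0.le) (hnn (Set.Iio R) (α - 2) _ (norm_nonneg u))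
  have i3 := mul_nonneg (zero_le_three (α := ℝ))
    (hnn (Set.Ici R) (α - 2 - 1) _ (norm_nonneg u))
  have tri : ‖z‖ ≤ ‖u‖ + ‖z - u‖ := by
    simpa [add_comm] using norm_add_le u (z - u)
  rw [norm_mul, norm_inv, Complex.norm_real, norm_mul, Real.norm_eq_abs,
    Real.norm_of_nonneg (by positivity : 0 ≤ ‖u‖ ^ (α - 2)), mul_assoc]
  refine mul_le_mul_of_nonneg_left ?_ (abs_nonneg C)
  simp only [Pi.add_apply]
  by_cases c1 : ‖z - u‖ < R
  · have : ‖u‖ ^ (α - 2) * ‖z - u‖⁻¹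
        ≤ R ^ (α - 2) * (Set.Iio R).indicator (fun y => y ^ (-1 : ℝ)) ‖z - u‖ := by
      rw [Set.indicator_of_mem (Set.mem_Iio.2 c1), rpow_neg_one]
      exact mul_le_mul_of_nonneg_right
        (rpow_le_rpow_of_nonpos hR0 (by linarith) (by linarith)) (by positivity)
    linarith
  by_cases c2 : ‖u‖ < R
  · have : ‖u‖ ^ (α - 2) * ‖z - u‖⁻¹
        ≤ R⁻¹ * (Set.Iio R).indicator (fun y => y ^ (α - 2)) ‖u‖ := by
      rw [Set.indicator_of_mem (Set.mem_Iio.2 c2), mul_comm]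
      gcongr
      linarith
    linarith
  · push Not at c1 c2
    have : ‖u‖ ^ (α - 2) * ‖z - u‖⁻¹
        ≤ 3 * (Set.Ici R).indicator (fun y => y ^ (α - 2 - 1)) ‖u‖ := by
      rw [Set.indicator_of_mem (Set.mem_Ici.2 c2), rpow_sub_one (by linarith), div_eq_mul_inv,
        mul_left_comm]
      have tri' : ‖u‖ ≤ 3 * ‖z - u‖ := by
        have : ‖u‖ ≤ ‖z‖ + ‖z - u‖ := by
          simpa using norm_sub_le z (z - u)
        linarith
      gcongr
      rw [← div_eq_mul_inv, le_div_iff₀ (by linarith), inv_mul_le_iff₀ (by linarith)]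
      linarith
    linarith

theorem integral_inv_sub_circle {z : ℂ} (hz : z ≠ 0) {s : ℝ} (hs : 0 < s) (hsz : s ≠ ‖z‖) :
    ∫ θ in Set.Ioo (-π) π, (z - s * Complex.exp (θ * Complex.I))⁻¹
      = if s < ‖z‖ then 2 * π * z⁻¹ else 0 := by
  have hper : Function.Periodic (fun θ : ℝ => (z - s * Complex.exp (θ * Complex.I))⁻¹) (2 * π) := by
    intro θ
    have : ((θ + 2 * π : ℝ) : ℂ) * Complex.I = θ * Complex.I + 2 * π * Complex.I := by
      push_cast
      ring
    simp only [this, Complex.exp_periodic _]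
  have hne : ∀ w ∈ sphere (0 : ℂ) s, w - z ≠ 0 := fun w hw h => hsz <| by
    rw [← sub_eq_zero.1 h]
    simpa using hw.symm
  have hci : ∀ w : ℂ, s ≠ ‖w‖ → CircleIntegrable (fun u => (u - w)⁻¹) 0 s := fun w hw => by
    rw [circleIntegrable_sub_inv_iff]
    right
    simpa [abs_of_pos hs] using hw.symm
  have hcircle : (∮ w in C(0, s), (Complex.I * z)⁻¹ * ((w - 0)⁻¹ - (w - z)⁻¹))
      = if s < ‖z‖ then 2 * π * z⁻¹ else 0 := by
    rw [circleIntegral.integral_const_mul, circleIntegral.integral_sub (hci 0 (by simp [hs.ne']))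
      (hci z hsz), circleIntegral.integral_sub_inv_of_mem_ball (by simpa using hs)]
    split_ifs with h
    · rw [Complex.circleIntegral_eq_zero_of_differentiable_on_off_countable hs.le
        Set.countable_empty]
      · field_simp
        simp
      · refine ContinuousOn.inv₀ (by fun_prop) fun w hw h0 => ?_
        rw [sub_eq_zero.1 h0] at hw
        simp at hw
        linarith
      · intro w hw
        refine DifferentiableAt.inv (by fun_prop) fun h0 => ?_
        rw [sub_eq_zero.1 h0] at hw
        simp at hw
        linarith
    · rw [circleIntegral.integral_sub_inv_of_mem_ball, sub_self, mul_zero]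
      simpa using lt_of_le_of_ne (not_lt.1 h) hsz.symm
  rw [← hcircle, circleIntegral, ← integral_Ioc_eq_integral_Ioo,
    ← intervalIntegral.integral_of_le (by linarith [pi_pos])]
  have h2 := hper.intervalIntegral_add_eq (-π) 0
  rw [show -π + 2 * π = π by ring, zero_add] at h2
  rw [h2]
  refine intervalIntegral.integral_congr fun θ _ => ?_
  have h3 := hne _ (circleMap_mem_sphere 0 hs.le θ)
  have h4 : circleMap 0 s θ ≠ 0 := circleMap_ne_center hs.ne'
  have h5 : (s : ℂ) * Complex.exp (θ * Complex.I) = circleMap 0 s θ := by simp [circleMap]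
  have h6 : z - circleMap 0 s θ ≠ 0 := fun h => h3 (by rw [← neg_sub, h, neg_zero])
  simp only [deriv_circleMap, smul_eq_mul, sub_zero, h5]
  field_simp
  ring

/-- The conjugate velocity, up to a factor, of the radial limit measure. -/
theorem integral_inv_sub_radial {α : ℝ} (hα0 : 0 < α) (hα1 : α < 1) {z : ℂ} (hz : z ≠ 0) :
    ∫ u, (z - u)⁻¹ ∂((volume : Measure ℂ).withDensity
      (fun u => ENNReal.ofReal (α / (2 * π) * ‖u‖ ^ (α - 2))))
      = ((‖z‖ ^ α : ℝ) : ℂ) * z⁻¹ := by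
  rw [integral_withDensity_eq_integral_toReal_smul (by fun_prop)
      (Eventually.of_forall fun _ => ENNReal.ofReal_lt_top)]
  have hreal : ∀ u : ℂ, (ENNReal.ofReal (α / (2 * π) * ‖u‖ ^ (α - 2))).toReal • (z - u)⁻¹
      = ((α / (2 * π) * ‖u‖ ^ (α - 2) : ℝ) : ℂ) * (z - u)⁻¹ := fun u => by
    rw [ENNReal.toReal_ofReal (by positivity), Complex.real_smul]
  simp_rw [hreal]
  have hint := integrable_rpow_norm_mul_inv_sub hα0 hα1 hz (α / (2 * π))
  set f : ℂ → ℂ := fun u => ((α / (2 * π) * ‖u‖ ^ (α - 2) : ℝ) : ℂ) * (z - u)⁻¹ with hf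
  have hfm : Measurable f := by fun_prop
  have hpm : Measurable fun p : ℝ × ℝ => Complex.polarCoord.symm p := by
    simp only [Complex.polarCoord_symm_apply]
    fun_prop
  have hint' : IntegrableOn (fun p : ℝ × ℝ => p.1 • f (Complex.polarCoord.symm p))
      polarCoord.target := by
    refine ⟨(measurable_fst.smul (hfm.comp hpm)).aestronglyMeasurable, ?_⟩
    have h := hint.2
    rw [hasFiniteIntegral_iff_enorm, ← Complex.lintegral_comp_polarCoord_symm] at h
    rw [hasFiniteIntegral_iff_enorm]
    convert h using 1
    refine setLIntegral_congr_fun polarCoord.open_target.measurableSet fun p hp => ?_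
    have hp1 : 0 < p.1 := hp.1
    simp only [enorm_smul, smul_eq_mul]
    rw [Real.enorm_of_nonneg hp1.le]
  rw [← Complex.integral_comp_polarCoord_symm, polarCoord_target, Measure.volume_eq_prod]
  rw [polarCoord_target, Measure.volume_eq_prod] at hint'
  rw [setIntegral_prod _ hint']
  have hinner : ∀ᵐ s : ℝ ∂(volume.restrict (Set.Ioi 0)),
      ∫ θ in Set.Ioo (-π) π, s • f (Complex.polarCoord.symm (s, θ))
      = (Set.Iio ‖z‖).indicator (fun s => ((α * s ^ (α - 1) : ℝ) : ℂ) * z⁻¹) s := by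
    filter_upwards [ae_restrict_mem measurableSet_Ioi,
      ae_restrict_of_ae (Measure.ae_ne volume ‖z‖)] with s hs hsz
    have hs : 0 < s := hs
    have e : ∀ θ : ℝ, s • f (Complex.polarCoord.symm (s, θ))
        = ((s * (α / (2 * π) * s ^ (α - 2)) : ℝ) : ℂ)
          * (z - s * Complex.exp (θ * Complex.I))⁻¹ := fun θ => by
      have h1 : Complex.polarCoord.symm (s, θ) = s * Complex.exp (θ * Complex.I) := by
        rw [Complex.polarCoord_symm_apply, Complex.exp_mul_I, Complex.ofReal_cos,
          Complex.ofReal_sin]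
      have h2 : ‖(s : ℂ) * Complex.exp (θ * Complex.I)‖ = s := by
        rw [norm_mul, Complex.norm_exp_ofReal_mul_I, mul_one, Complex.norm_of_nonneg hs.le]
      rw [h1, hf]
      simp only [h2]
      rw [Complex.real_smul, ← mul_assoc, ← Complex.ofReal_mul]
    simp_rw [e]
    rw [integral_const_mul, integral_inv_sub_circle hz hs hsz]
    by_cases h : s < ‖z‖
    · rw [if_pos h, Set.indicator_of_mem (Set.mem_Iio.2 h),
        show α - 1 = α - 2 + 1 by ring, rpow_add_one hs.ne']
      have : (π : ℂ) ≠ 0 := by exact_mod_cast pi_ne_zero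
      push_cast
      field_simp
    · rw [if_neg h, Set.indicator_of_notMem (by simpa using h), mul_zero]
  rw [integral_congr_ae hinner, setIntegral_indicator measurableSet_Iio, Set.Ioi_inter_Iio,
    integral_mul_const, integral_complex_ofReal, integral_const_mul,
    ← integral_Ioc_eq_integral_Ioo, ← intervalIntegral.integral_of_le (norm_nonneg z),
    integral_rpow (Or.inl (by linarith)), sub_add_cancel, zero_rpow hα0.ne', sub_zero,
    mul_div_cancel₀ _ hα0.ne']

theorem tendsto_lintegral_enorm_sq {X ι : Type*} [MeasurableSpace X] {ν : Measure X}
    {l : Filter ι} {g : ι → X → ℂ} {f : X → ℂ} (hg : ∀ t, AEStronglyMeasurable (g t) ν)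
    (hf : AEStronglyMeasurable f ν)
    (h : Tendsto (fun t => ∫⁻ x, ‖g t x - f x‖ₑ ^ 2 ∂ν) l (𝓝 0)) :
    Tendsto (fun t => ∫⁻ x, ‖g t x‖ₑ ^ 2 ∂ν) l (𝓝 (∫⁻ x, ‖f x‖ₑ ^ 2 ∂ν)) := by
  have hE : ∀ u : X → ℂ, ∫⁻ x, ‖u x‖ₑ ^ 2 ∂ν = eLpNorm u 2 ν ^ 2 := fun u => by
    have := eLpNorm_nnreal_pow_eq_lintegral (f := u) (μ := ν) (p := 2) two_ne_zero
    simpa using this.symm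
  have hd : Tendsto (fun t => eLpNorm (g t - f) 2 ν) l (𝓝 0) := by
    have h2 := (ENNReal.continuous_rpow_const (y := 1 / 2)).tendsto 0 |>.comp h
    rw [ENNReal.zero_rpow_of_pos (by norm_num)] at h2
    refine h2.congr fun t => ?_
    have h3 := hE (g t - f)
    simp only [Pi.sub_apply] at h3
    rw [Function.comp_apply, h3, ← ENNReal.rpow_natCast, ← ENNReal.rpow_mul]
    norm_num
  simp_rw [hE]
  refine ENNReal.Tendsto.pow ?_
  have hlow : Tendsto (fun t => eLpNorm f 2 ν - eLpNorm (g t - f) 2 ν) l (𝓝 (eLpNorm f 2 ν)) := by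
    simpa using ENNReal.Tendsto.sub (tendsto_const_nhds (x := eLpNorm f 2 ν)) hd
      (Or.inr ENNReal.zero_ne_top)
  have hup : Tendsto (fun t => eLpNorm f 2 ν + eLpNorm (g t - f) 2 ν) l (𝓝 (eLpNorm f 2 ν)) := by
    simpa using (tendsto_const_nhds (x := eLpNorm f 2 ν)).add hd
  refine tendsto_of_tendsto_of_tendsto_of_le_of_le hlow hup (fun t => ?_) (fun t => ?_)
  · rw [tsub_le_iff_right]
    have := eLpNorm_sub_le (hg t) ((hg t).sub hf) one_le_two
    rwa [sub_sub_cancel] at this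
  · have := eLpNorm_add_le hf ((hg t).sub hf) one_le_two
    rwa [add_sub_cancel] at this

theorem lintegral_ball_le_polar (f : ℂ → ℝ≥0∞) (r : ℝ) :
    ∫⁻ x in ball (0 : ℂ) r, f x ≤ ∫⁻ s in Set.Ioo 0 r, ENNReal.ofReal s *
      ∫⁻ θ in Set.Ioo (-π) π, f (s * Complex.exp (θ * Complex.I)) := by
  rw [← lintegral_indicator measurableSet_ball, ← Complex.lintegral_comp_polarCoord_symm,
    polarCoord_target, Measure.volume_eq_prod, ← Measure.prod_restrict]
  refine (lintegral_prod_le _).trans ?_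
  have hi : Set.Ioo 0 r = Set.Iio r ∩ Set.Ioi 0 := by rw [Set.inter_comm, Set.Ioi_inter_Iio]
  rw [hi, ← setLIntegral_indicator measurableSet_Iio]
  refine setLIntegral_mono_ae' measurableSet_Ioi (Eventually.of_forall fun s hs => ?_)
  have hs : 0 < s := hs
  simp only [smul_eq_mul]
  rw [lintegral_const_mul' _ _ ENNReal.ofReal_ne_top]
  have e : ∀ θ : ℝ, Complex.polarCoord.symm (s, θ) = s * Complex.exp (θ * Complex.I) :=
    fun θ => by
      rw [Complex.polarCoord_symm_apply, Complex.exp_mul_I, Complex.ofReal_cos, Complex.ofReal_sin]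
  have hn : ∀ θ : ℝ, ‖(s : ℂ) * Complex.exp (θ * Complex.I)‖ = s := fun θ => by
    rw [norm_mul, Complex.norm_exp_ofReal_mul_I, mul_one, Complex.norm_of_nonneg hs.le]
  have hb : ∀ θ : ℝ, s * Complex.exp (θ * Complex.I) ∈ ball (0 : ℂ) r ↔ s < r := fun θ => by
    rw [mem_ball_zero_iff, hn]
  by_cases h : s < r
  · rw [Set.indicator_of_mem (Set.mem_Iio.2 h)]
    simp only [e, Set.indicator_of_mem ((hb _).2 h), le_refl]
  · have hz : ∀ θ : ℝ, (ball (0 : ℂ) r).indicator f (s * Complex.exp (θ * Complex.I)) = 0 :=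
      fun θ => Set.indicator_of_notMem (mt (hb θ).1 h) f
    simp [e, hz]

theorem lintegral_ball_kadenCauchy_sub_le (μ t : ℝ) {α : ℝ} (hα0 : 0 < α) (hα1 : α < 1) (r : ℝ) :
    ∫⁻ x in ball (0 : ℂ) r, ‖kadenCauchy μ α t x - ((‖x‖ ^ α : ℝ) : ℂ) * x⁻¹‖ₑ ^ 2
      ≤ ∫⁻ s in Set.Ioo 0 r, ENNReal.ofReal
        (4 * π * kadenDefect μ α (t * s ^ (-1 / μ)) * s ^ (2 * α - 1)) := by
  refine (lintegral_ball_le_polar _ r).trans (setLIntegral_mono_ae' measurableSet_Ioo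
    (Eventually.of_forall fun s hs => ?_))
  have hs : 0 < s := hs.1
  have e : ∀ θ : ℝ, ‖kadenCauchy μ α t (s * Complex.exp (θ * Complex.I))
      - ((‖(s : ℂ) * Complex.exp (θ * Complex.I)‖ ^ α : ℝ) : ℂ)
        * (s * Complex.exp (θ * Complex.I))⁻¹‖ₑ ^ 2
      = ENNReal.ofReal ((s ^ (α - 1)) ^ 2) *
        ‖kadenCauchy μ α (t * s ^ (-1 / μ)) (Complex.exp (θ * Complex.I))
          - (Complex.exp (θ * Complex.I))⁻¹‖ₑ ^ 2 := fun θ => by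
    have h1 : ((s ^ α : ℝ) : ℂ) * (s * Complex.exp (θ * Complex.I))⁻¹
        = ((s ^ (α - 1) : ℝ) : ℂ) * (Complex.exp (θ * Complex.I))⁻¹ := by
      rw [rpow_sub_one hs.ne', mul_inv]
      push_cast
      ring
    rw [norm_mul, Complex.norm_exp_ofReal_mul_I, mul_one, Complex.norm_of_nonneg hs.le, h1,
      kadenCauchy_mul μ α t hs, ← mul_sub, enorm_mul, mul_pow, ENNReal.ofReal_pow (by positivity),
      ← ofReal_norm, Complex.norm_of_nonneg (by positivity)]
  simp_rw [e]
  rw [lintegral_const_mul' _ _ ENNReal.ofReal_ne_top]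
  calc _ ≤ ENNReal.ofReal s * (ENNReal.ofReal ((s ^ (α - 1)) ^ 2) *
        ENNReal.ofReal (4 * π * kadenDefect μ α (t * s ^ (-1 / μ)))) := by
        gcongr
        exact lintegral_circle_le μ _ hα0 hα1
    _ = _ := by
        rw [← ENNReal.ofReal_mul (by positivity), ← ENNReal.ofReal_mul (by positivity),
          show 2 * α - 1 = (α - 1) + (α - 1) + 1 by ring, rpow_add_one hs.ne', rpow_add hs]
        congr 1
        ring

theorem tendsto_lintegral_ball_kadenCauchy_sub {μ α : ℝ} (hμ : 0 < μ) (hα0 : 0 < α) (hα1 : α < 1)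
    {r : ℝ} (hr : 0 < r) :
    Tendsto (fun t => ∫⁻ x in ball (0 : ℂ) r,
      ‖kadenCauchy μ α t x - ((‖x‖ ^ α : ℝ) : ℂ) * x⁻¹‖ₑ ^ 2) atTop (𝓝 0) := by
  set K : ℝ≥0∞ := ∫⁻ s in Set.Ioo 0 r, ENNReal.ofReal (s ^ (2 * α - 1)) with hK
  have hKtop : K ≠ ⊤ := by
    have h := (intervalIntegral.integrableOn_Ioo_rpow_iff hr (s := 2 * α - 1)).2 (by linarith)
    refine ((lintegral_mono fun s => ?_).trans_lt h.2).ne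
    rw [← ofReal_norm]
    exact ENNReal.ofReal_le_ofReal (le_abs_self _)
  rw [ENNReal.tendsto_nhds_zero]
  intro ε hε
  have hδ : Tendsto (fun δ : ℝ => ENNReal.ofReal (4 * π * δ) * K) (𝓝[>] 0) (𝓝 0) := by
    have h := ENNReal.Tendsto.mul_const (b := K)
      (ENNReal.tendsto_ofReal ((continuous_const_mul (4 * π)).tendsto 0)) (Or.inr hKtop)
    simp only [mul_zero, ENNReal.ofReal_zero, zero_mul] at h
    exact h.mono_left nhdsWithin_le_nhds
  obtain ⟨δ, hδε, hδ0⟩ := ((ENNReal.tendsto_nhds_zero.1 hδ ε hε).and self_mem_nhdsWithin).exists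
  obtain ⟨T, hT⟩ := eventually_atTop.1
    ((tendsto_kadenDefect hμ hα0 hα1).eventually_le_const (show (0 : ℝ) < δ from hδ0))
  have hrpow : 0 < r ^ (-1 / μ) := rpow_pos_of_pos hr _
  filter_upwards [eventually_ge_atTop 0, eventually_ge_atTop (T / r ^ (-1 / μ))] with t ht0 htT
  refine (lintegral_ball_kadenCauchy_sub_le μ t hα0 hα1 r).trans (le_trans ?_ hδε)
  rw [hK, ← lintegral_const_mul' _ _ ENNReal.ofReal_ne_top]
  refine setLIntegral_mono_ae' measurableSet_Ioo (Eventually.of_forall fun s hs => ?_)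
  have hs0 : 0 < s := hs.1
  have hδ0 : 0 < δ := hδ0
  rw [← ENNReal.ofReal_mul (by positivity)]
  refine ENNReal.ofReal_le_ofReal ?_
  gcongr
  refine hT _ (((div_le_iff₀ hrpow).1 htT).trans ?_)
  exact mul_le_mul_of_nonneg_left
    (rpow_le_rpow_of_nonpos hs0 hs.2.le (div_nonpos_of_nonpos_of_nonneg (by norm_num) hμ.le)) ht0

/-- Proposition 4.4: as `t → ∞`, the Kaden velocity converges in `L²(B(0,r))` to the
velocity of the radial measure `ω_∞`; in particular the local kinetic energies converge. -/
theorem stmt17 (μ : ℝ) (hμ : μ ∈ Set.Ioo (1 / 2 : ℝ) 1) (α : ℝ) (hα : α = 2 - 1 / μ)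
    (r : ℝ) (hr : 0 < r) (ωinf : Measure ℂ)
    (hinf : ωinf = volume.withDensity
      (fun z => ENNReal.ofReal (α / (2 * π) * ‖z‖ ^ (α - 2)))) :
    Tendsto (fun t : ℝ => ∫⁻ x in ball (0 : ℂ) r,
        (‖biotSavart (kadenMeasure μ t) x - biotSavart ωinf x‖₊ : ℝ≥0∞) ^ 2)
      atTop (nhds 0) ∧
    Tendsto (fun t : ℝ => localEnergy (kadenMeasure μ t) r) atTop
      (nhds (localEnergy ωinf r)) := by
  obtain ⟨hμ1, hμ2⟩ := hμ
  have hμ0 : 0 < μ := by linarith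
  have hα0 : 0 < α := by
    have : 1 / μ < 2 := by rw [div_lt_iff₀ hμ0]; linarith
    linarith
  have hα1 : α < 1 := by
    have : 1 < 1 / μ := by rw [lt_div_iff₀ hμ0]; linarith
    linarith
  subst hinf
  have hlim : Tendsto (fun t : ℝ => ∫⁻ x in ball (0 : ℂ) r,
      ‖biotSavart (kadenMeasure μ t) x - biotSavart ((volume : Measure ℂ).withDensity
        (fun z => ENNReal.ofReal (α / (2 * π) * ‖z‖ ^ (α - 2)))) x‖ₑ ^ 2) atTop (𝓝 0) := by
    refine tendsto_of_tendsto_of_tendsto_of_le_of_le tendsto_const_nhds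
      (tendsto_lintegral_ball_kadenCauchy_sub hμ0 hα0 hα1 hr) (fun _ => zero_le) fun t => ?_
    refine lintegral_mono_ae ?_
    filter_upwards [ae_restrict_of_ae (Measure.ae_ne volume (0 : ℂ))] with x hx
    rw [← integral_inv_sub_kadenMeasure hα hα0, ← integral_inv_sub_radial hα0 hα1 hx]
    gcongr
    exact enorm_biotSavart_sub_le _ _ x
  exact ⟨hlim, tendsto_lintegral_enorm_sq
    (fun t => (stronglyMeasurable_biotSavart _).aestronglyMeasurable)
    (stronglyMeasurable_biotSavart _).aestronglyMeasurable hlim⟩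
end
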